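/- For every λ > 0 and every translation-invariant jump distribution P on ℤ^d, the critical density of activated random walk satisfies ρ_c(ℤ^d, P, λ) ≤ G(ℤ^d, P) · λ_s, where λ_s = λ/(1+λ). -/

import Mathlib

/-!
Common framework for the activated random walk (ARW) model on `ℤ^d`,
via the site-wise (Diaconis–Fulton) representation.
-/

open MeasureTheory ENNReal Filter

namespace ARW

noncomputable section
open scoped Classical

/-- A site of the lattice `ℤ^d`. -/
abbrev Site (d : ℕ) := Fin d → ℤ

/-- An instruction: `none` is a sleep instruction, `some z` is a jump instruction
with displacement `z`. -/
abbrev Instr (d : ℕ) := Option (Site d)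

instance (d : ℕ) : MeasurableSpace (Instr d) := ⊤

/-- The array of instruction stacks: `I (x, k)` is the `k`-th instruction at site `x`. -/
abbrev Stacks (d : ℕ) := Site d × ℕ → Instr d

/-- The state of a site: `active n` means `n` active particles (and no sleeping one),
`sleeping` means a single sleeping particle. -/
inductive SiteState : Type
  | active : ℕ → SiteState
  | sleeping : SiteState
  deriving DecidableEq

/-- A particle configuration. -/
abbrev Config (d : ℕ) := Site d → SiteState

/-- Number of active particles at a site state. -/
def numActive : SiteState → ℕ
  | .active n => n
  | .sleeping => 0

/-- Adding one (active) particle to a site: a sleeping particle is reactivated. -/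
def addParticle : SiteState → SiteState
  | .active n => .active (n + 1)
  | .sleeping => .active 2

/-- A state of the system: a configuration together with an odometer
(number of instructions already used at each site). -/
abbrev State (d : ℕ) := Config d × (Site d → ℕ)

/-- Initial state on `V` obtained from an all-active particle count `η` (particles
outside `V` are discarded), with odometer `0`. -/
def initState (d : ℕ) (V : Finset (Site d)) (η : Site d → ℕ) : State d :=
  (fun x => .active (if x ∈ V then η x else 0), fun _ => 0)

/-- Toppling the site `x` (inside `V`, particles jumping out of `V` are killed):
the next unused instruction at `x` is executed and the odometer at `x` increases by one.
A sleep instruction puts the particle at `x` to sleep if it is alone (otherwise it has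
no effect), and a jump instruction moves one particle from `x` to `x + z`
(reactivating a sleeping particle there), killing it if `x + z ∉ V`. -/
def topple {d : ℕ} (V : Finset (Site d)) (I : Stacks d) (x : Site d) (s : State d) :
    State d :=
  let σ := s.1
  let m := s.2
  let σ' : Config d :=
    match I (x, m x) with
    | none => if numActive (σ x) = 1 then Function.update σ x .sleeping else σ
    | some z =>
        let σ₁ := Function.update σ x (SiteState.active (numActive (σ x) - 1))
        if x + z ∈ V then Function.update σ₁ (x + z) (addParticle (σ₁ (x + z))) else σ₁
  (σ', Function.update m x (m x + 1))

/-- Running a sequence of topplings. -/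
def run {d : ℕ} (V : Finset (Site d)) (I : Stacks d) : State d → List (Site d) → State d
  | s, [] => s
  | s, x :: l => run V I (topple V I x s) l

/-- Legality of a toppling sequence: every toppled site lies in `V` and holds at least one
active particle when toppled. -/
def Legal {d : ℕ} (V : Finset (Site d)) (I : Stacks d) : State d → List (Site d) → Prop
  | _, [] => True
  | s, x :: l => x ∈ V ∧ 1 ≤ numActive (s.1 x) ∧ Legal V I (topple V I x s) l

/-- A configuration is stable in `V` if no site of `V` holds an active particle. -/
def Stable {d : ℕ} (V : Finset (Site d)) (σ : Config d) : Prop :=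
  ∀ x ∈ V, numActive (σ x) = 0

/-- The stabilization of `η` in `V` terminates. -/
def StabCompletes {d : ℕ} (V : Finset (Site d)) (I : Stacks d) (η : Site d → ℕ) : Prop :=
  ∃ l, Legal V I (initState d V η) l ∧ Stable V (run V I (initState d V η) l).1

/-- The stable configuration `Stab_V η` (well defined, independently of the chosen legal
toppling sequence, by the abelian property), when stabilization terminates. -/
def stabConfig {d : ℕ} (V : Finset (Site d)) (I : Stacks d) (η : Site d → ℕ) : Config d :=
  if h : StabCompletes V I η then (run V I (initState d V η) h.choose).1
  else fun _ => .active 0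

/-- The event `0 ∈ Stab_V η`: stabilization of `η` in `V` ends with a sleeping particle
at the origin. -/
def SleepAt0 {d : ℕ} (V : Finset (Site d)) (I : Stacks d) (η : Site d → ℕ) : Prop :=
  StabCompletes V I η ∧ stabConfig V I η 0 = .sleeping

/-- The event `0 ∉ Stab_V η`: stabilization of `η` in `V` ends with the origin empty. -/
def EmptyAt0 {d : ℕ} (V : Finset (Site d)) (I : Stacks d) (η : Site d → ℕ) : Prop :=
  StabCompletes V I η ∧ stabConfig V I η 0 ≠ .sleeping

/-- The limiting odometer of `η` at the origin: the supremum, over finite volumes `V` and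
legal toppling sequences in `V`, of the number of topplings performed at the origin. -/
def odom0 {d : ℕ} (I : Stacks d) (η : Site d → ℕ) : ℕ∞ :=
  ⨆ (V : Finset (Site d)) (l : List (Site d)) (_ : Legal V I (initState d V η) l),
    (l.count 0 : ℕ∞)

/-! ### The random instructions -/

/-- The normalized sleep rate `λ_s = λ/(1+λ)`. -/
def lamS (lam : ℝ) : ℝ := lam / (1 + lam)

/-- The normalized jump rate `λ_J = 1/(1+λ)`. -/
def lamJ (lam : ℝ) : ℝ := 1 / (1 + lam)

/-- The distribution of a single instruction: sleep with probability `λ_s`, jump by `z`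
with probability `λ_J · step z`. -/
def instrWeight {d : ℕ} (step : Site d → ℝ) (lam : ℝ) : Instr d → ℝ≥0∞
  | none => ENNReal.ofReal (lamS lam)
  | some z => ENNReal.ofReal (lamJ lam) * ENNReal.ofReal (step z)

/-- `μ` is the law of the i.i.d. instruction stacks: a probability measure whose
finite-dimensional cylinder probabilities are the products of the `instrWeight`s. -/
def IsStackLaw (d : ℕ) (step : Site d → ℝ) (lam : ℝ) (μ : Measure (Stacks d)) : Prop :=
  IsProbabilityMeasure μ ∧
    ∀ (F : Finset (Site d × ℕ)) (g : Site d × ℕ → Instr d),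
      μ {I | ∀ i ∈ F, I i = g i} = ∏ i ∈ F, instrWeight step lam (g i)

/-- The law of the i.i.d. instruction stacks (uniquely determined by its cylinder
probabilities; it exists whenever `step` is a probability distribution and `λ > 0`). -/
def stackLaw (d : ℕ) (step : Site d → ℝ) (lam : ℝ) : Measure (Stacks d) :=
  if h : ∃ μ, IsStackLaw d step lam μ then h.choose else 0

/-! ### Fixation and the critical density -/

/-- Translation of a particle count by `z`. -/
def shift {d : ℕ} (z : Site d) (η : Site d → ℕ) : Site d → ℕ := fun x => η (x + z)

/-- A translation-ergodic distribution of particles: invariant under all translations,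
and every translation-invariant event is trivial. -/
def IsTransErgodic {d : ℕ} (ν : Measure (Site d → ℕ)) : Prop :=
  (∀ z, Measure.map (shift z) ν = ν) ∧
    ∀ s : Set (Site d → ℕ), MeasurableSet s → (∀ z, shift z ⁻¹' s = s) → ν s = 0 ∨ ν s = 1

/-- Almost sure fixation of the initial distribution `ν`: for `ν`-almost every initial
configuration and almost every instructions, the limiting odometer at the origin is
finite (equivalently, by Amir–Gurel-Gurevich, every particle eventually sleeps forever). -/
def Fixates (d : ℕ) (step : Site d → ℝ) (lam : ℝ) (ν : Measure (Site d → ℕ)) : Prop :=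
  ∀ᵐ η ∂ν, ∀ᵐ I ∂(stackLaw d step lam), odom0 I η ≠ ⊤

/-- The critical density `ρ_c(ℤ^d, P, λ)`: the supremum of the densities `ρ` such that
every translation-ergodic probability distribution of active particles with mean `ρ`
particles per site fixates almost surely. -/
def critDensity (d : ℕ) (step : Site d → ℝ) (lam : ℝ) : ℝ :=
  sSup {ρ : ℝ | 0 ≤ ρ ∧
    ∀ ν : Measure (Site d → ℕ), IsProbabilityMeasure ν → IsTransErgodic ν →
      (∫⁻ η, (η 0 : ℝ≥0∞) ∂ν) = ENNReal.ofReal ρ → Fixates d step lam ν}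

/-! ### Random walk quantities -/

/-- Simple symmetric nearest-neighbour step distribution on `ℤ^d`. -/
def ssrwStep (d : ℕ) : Site d → ℝ :=
  fun z => if (∑ i, (z i).natAbs) = 1 then (1 : ℝ) / (2 * d) else 0

/-- `psum w k` : position after the first `k` steps with increments `w`. -/
def psum {d n : ℕ} (w : Fin n → Site d) (k : ℕ) : Site d :=
  ∑ i ∈ Finset.univ.filter (fun i : Fin n => (i : ℕ) < k), w i

/-- Probability of a given sequence of increments. -/
def pathProb {d n : ℕ} (step : Site d → ℝ) (w : Fin n → Site d) : ℝ := ∏ i, step (w i)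

/-- `P(S_n = 0)` for the discrete-time walk started at `0`. -/
def probAt0 {d : ℕ} (step : Site d → ℝ) (n : ℕ) : ℝ :=
  ∑' w : Fin n → Site d, if psum w n = 0 then pathProb step w else 0

/-- The Green's function `G = Σ_{n ≥ 0} P(S_n = 0)` of the walk, valued in `[0, ∞]`.
The walk is transient iff `greenE step < ∞`. -/
def greenE {d : ℕ} (step : Site d → ℝ) : ℝ≥0∞ :=
  ∑' n : ℕ, ENNReal.ofReal (probAt0 step n)

/-- Probability that the walk returns to `0` for the first time at time `n`, having
stayed inside `A` at all intermediate times. -/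
def returnIn {d : ℕ} (step : Site d → ℝ) (A : Set (Site d)) (n : ℕ) : ℝ :=
  ∑' w : Fin n → Site d,
    if (∀ k, 0 < k → k < n → psum w k ≠ 0 ∧ psum w k ∈ A) ∧ psum w n = 0
    then pathProb step w else 0

/-- `P(τ = n)` where `τ` is the first return time to the origin. -/
def firstReturn {d : ℕ} (step : Site d → ℝ) (n : ℕ) : ℝ := returnIn step Set.univ n

/-- The probability that the walk started at `0` exits `A` strictly before returning
to `0`. -/
def escProb {d : ℕ} (step : Site d → ℝ) (A : Set (Site d)) : ℝ :=
  ∑' n : ℕ, ∑' w : Fin (n + 1) → Site d,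
    if (∀ k, 0 < k → k ≤ n → psum w k ≠ 0 ∧ psum w k ∈ A) ∧ psum w (n + 1) ∉ A
    then pathProb step w else 0

/-- `q(ℤ^d, P, λ)`: the probability that a single particle started at the origin falls
asleep at the origin, i.e. that the walk is at `0` after `N` steps where
`P(N = n) = λ_s λ_J^n`. -/
def qProb {d : ℕ} (step : Site d → ℝ) (lam : ℝ) : ℝ :=
  ∑' n : ℕ, lamS lam * lamJ lam ^ n * probAt0 step n

/-- The ball `B_r = {x : ‖x‖₁ ≤ r}`. -/
def ball (d : ℕ) (r : ℝ) : Set (Site d) := {x | ((∑ i, (x i).natAbs : ℕ) : ℝ) ≤ r}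

/-- `η` fills `A`: at least one particle at each site of `A`. -/
def Fills {d : ℕ} (η : Site d → ℕ) (A : Set (Site d)) : Prop := ∀ x ∈ A, 1 ≤ η x

/-! ### Weak stabilization, strong stabilization and the number of chances -/

/-- Legality of a weak toppling sequence (with respect to the origin): off the origin as
usual, while the origin may only be toppled if it holds at least two active particles. -/
def WLegal {d : ℕ} (V : Finset (Site d)) (I : Stacks d) : State d → List (Site d) → Prop
  | _, [] => True
  | s, x :: l => x ∈ V ∧ (if x = 0 then 2 else 1) ≤ numActive (s.1 x) ∧
      WLegal V I (topple V I x s) l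

/-- Weak stability in `V` with respect to the origin. -/
def WStable {d : ℕ} (V : Finset (Site d)) (σ : Config d) : Prop :=
  numActive (σ 0) ≤ 1 ∧ ∀ x ∈ V, x ≠ 0 → numActive (σ x) = 0

/-- The weak stabilization of a state (well defined by the abelian property whenever it
terminates). -/
def weakStab {d : ℕ} (V : Finset (Site d)) (I : Stacks d) (s : State d) : State d :=
  if h : ∃ l, WLegal V I s l ∧ WStable V (run V I s l).1 then run V I s h.choose else s

/-- The jump-out step: the particle at the origin is acceptably toppled (consuming
instructions at the origin, ignoring the sleep instructions) until it jumps out. -/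
def jumpOut {d : ℕ} (V : Finset (Site d)) (I : Stacks d) (s : State d) : State d :=
  if h : ∃ k, (I (0, s.2 0 + k)).isSome then
    let k := Nat.find h
    let z := (I (0, s.2 0 + k)).get (Nat.find_spec h)
    let σ₁ := Function.update s.1 0 (SiteState.active (numActive (s.1 0) - 1))
    let σ' := if (0 : Site d) + z ∈ V then
        Function.update σ₁ ((0 : Site d) + z) (addParticle (σ₁ ((0 : Site d) + z)))
      else σ₁
    (σ', Function.update s.2 0 (s.2 0 + k + 1))
  else s

/-- The states of the strong stabilization of `η` on `V` with respect to the origin via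
successive weak stabilizations: `procState j` is the state after the `(j+1)`-st weak
stabilization; as long as the origin holds an active particle, it is jumped out and the
configuration is weakly stabilized again. -/
def procState {d : ℕ} (V : Finset (Site d)) (I : Stacks d) (η : Site d → ℕ) :
    ℕ → State d
  | 0 => weakStab V I (initState d V η)
  | j + 1 =>
      let s := procState V I η j
      if 1 ≤ numActive (s.1 0) then weakStab V I (jumpOut V I s) else s

/-- The number of chances `Ch(η, V)`: the number of completed iterations of the strong
stabilization procedure, i.e. the first `j` such that the origin is empty after the
`(j+1)`-st weak stabilization. -/
def chances {d : ℕ} (V : Finset (Site d)) (I : Stacks d) (η : Site d → ℕ) : ℕ∞ :=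
  if h : ∃ j, numActive ((procState V I η j).1 0) = 0 then (Nat.find h : ℕ∞) else ⊤

/-- The `j`-th weakly stable configuration `η^W_j` (for `1 ≤ j`). -/
def weakConfig {d : ℕ} (V : Finset (Site d)) (I : Stacks d) (η : Site d → ℕ) (j : ℕ) :
    Config d :=
  (procState V I η (j - 1)).1

/-- The `j`-th sleep trial `b_j` (for `1 ≤ j`): whether the first instruction used in the
`j`-th jump-out step is a sleep instruction. -/
def sleepTrial {d : ℕ} (V : Finset (Site d)) (I : Stacks d) (η : Site d → ℕ) (j : ℕ) :
    Prop :=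
  I (0, (procState V I η (j - 1)).2 0) = none

/-- `a^n` for `n ∈ ℕ∞`, with `a^∞ = 0` (appropriate for `a < 1`). -/
def enpow (a : ℝ≥0∞) : ℕ∞ → ℝ≥0∞
  | ⊤ => 0
  | (n : ℕ) => a ^ n

end
end ARW

open MeasureTheory ENNReal Filter Topology ARW


open MeasureTheory ENNReal Filter Topology ARW

set_option linter.all false

namespace ARWP
noncomputable section

open Finset

/-- total number of particles (active or asleep) -/
def cnt : SiteState → ℕ
  | .active n => n
  | .sleeping => 1

/-- parameters of the chain on a finite set -/
structure Sys (V : Type) [Fintype V] [DecidableEq V] where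
  p : V → V → ℝ
  s : ℝ
  H : V → ℝ
  hp : ∀ y z, 0 ≤ p y z
  hp1 : ∀ y, ∑ z, p y z ≤ 1
  hs : 0 < s
  hs1 : s < 1
  hH : ∀ y, 1 + ∑ z, p y z * H z ≤ H y
  hH0 : ∀ y, 0 ≤ H y

variable {V : Type} [Fintype V] [DecidableEq V]

abbrev Cfg (V : Type) := V → SiteState

def addO : Option V → Cfg V → Cfg V
  | none, σ => σ
  | some z, σ => Function.update σ z (addParticle (σ z))

def act (y : V) : Option (Option V) → Cfg V → Cfg V
  | none, σ => if numActive (σ y) = 1 then Function.update σ y .sleeping else σ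
  | some o, σ => addO o (Function.update σ y (.active (numActive (σ y) - 1)))

namespace Sys

def wt (S : Sys V) (y : V) : Option (Option V) → ℝ
  | none => S.s
  | some none => (1 - S.s) * (1 - ∑ z, S.p y z)
  | some (some z) => (1 - S.s) * S.p y z

lemma wt_nonneg (S : Sys V) (y o) : 0 ≤ S.wt y o := by
  have := S.hs; have := S.hs1
  rcases o with _ | _ | z
  · exact S.hs.le
  · exact mul_nonneg (by linarith) (by linarith [S.hp1 y])
  · exact mul_nonneg (by linarith) (S.hp y z)

/-- expectation over the instruction used at `y` -/
def E (S : Sys V) (y : V) (f : Option (Option V) → ℝ) : ℝ := ∑ o, S.wt y o * f o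

lemma E_eq (S : Sys V) (y : V) (f : Option (Option V) → ℝ) :
    S.E y f = S.s * f none + (1 - S.s) * ((1 - ∑ z, S.p y z) * f (some none)
      + ∑ z, S.p y z * f (some (some z))) := by
  simp only [E, Fintype.sum_option, wt, mul_add, Finset.mul_sum]
  congr 1
  congr 1
  · ring
  · refine Finset.sum_congr rfl fun z _ => by ring

lemma E_mono (S : Sys V) {y : V} {f g : Option (Option V) → ℝ} (h : ∀ o, f o ≤ g o) :
    S.E y f ≤ S.E y g :=
  Finset.sum_le_sum fun o _ => mul_le_mul_of_nonneg_left (h o) (S.wt_nonneg y o)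

lemma E_add (S : Sys V) (y : V) (f g : Option (Option V) → ℝ) :
    S.E y (fun o => f o + g o) = S.E y f + S.E y g := by
  simp [E, mul_add, Finset.sum_add_distrib]

lemma E_sub (S : Sys V) (y : V) (f g : Option (Option V) → ℝ) :
    S.E y (fun o => f o - g o) = S.E y f - S.E y g := by
  simp [E, mul_sub, Finset.sum_sub_distrib]

lemma E_smul (S : Sys V) (y : V) (c : ℝ) (f : Option (Option V) → ℝ) :
    S.E y (fun o => c * f o) = c * S.E y f := by
  simp only [E, Finset.mul_sum]
  refine Finset.sum_congr rfl fun z _ => by ring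

lemma E_sum (S : Sys V) {ι : Type} (t : Finset ι) (y : V) (f : ι → Option (Option V) → ℝ) :
    S.E y (fun o => ∑ i ∈ t, f i o) = ∑ i ∈ t, S.E y (f i) := by
  simp only [E, Finset.mul_sum]
  rw [Finset.sum_comm]

lemma E_const (S : Sys V) (y : V) (c : ℝ) : S.E y (fun _ => c) = c := by
  rw [E_eq, ← Finset.sum_mul]; ring

lemma E_comm (S : Sys V) (y z : V) (f : Option (Option V) → Option (Option V) → ℝ) :
    S.E y (fun o => S.E z (fun o' => f o o')) = S.E z (fun o' => S.E y (fun o => f o o')) := by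
  simp only [E, Finset.mul_sum]
  rw [Finset.sum_comm]
  refine Finset.sum_congr rfl fun a _ => Finset.sum_congr rfl fun b _ => by ring

end Sys

/-! ### Elementary facts about the moves -/

lemma numActive_add (a : SiteState) : numActive a ≤ numActive (addParticle a) := by
  cases a <;> simp [numActive, addParticle]

lemma cnt_add (a : SiteState) : cnt (addParticle a) = cnt a + 1 := by
  cases a <;> simp [cnt, addParticle]

lemma addO_apply (z : Option V) (σ : Cfg V) (x : V) :
    addO z σ x = if z = some x then addParticle (σ x) else σ x := by
  cases z with
  | none => simp [addO]
  | some z =>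
    by_cases h : z = x
    · subst h; simp [addO]
    · simp [addO, h, Function.update_of_ne (Ne.symm h)]

lemma act_none_apply (y : V) (σ : Cfg V) (x : V) :
    act y none σ x = if x = y ∧ numActive (σ y) = 1 then .sleeping else σ x := by
  by_cases h : numActive (σ y) = 1
  · by_cases hx : x = y
    · subst hx; simp [act, h]
    · simp [act, h, hx]
  · simp [act, h]

lemma act_some_apply (y : V) (o : Option V) (σ : Cfg V) (x : V) :
    act y (some o) σ x =
      let a := if x = y then SiteState.active (numActive (σ y) - 1) else σ x
      if o = some x then addParticle a else a := by
  simp only [act, addO_apply, Function.update_apply]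

lemma active_of_numActive {a : SiteState} (h : 1 ≤ numActive a) : ∃ n, a = .active (n + 1) := by
  cases a with
  | active n => exact ⟨n - 1, by simp [numActive] at h ⊢; omega⟩
  | sleeping => simp [numActive] at h

lemma numActive_act {y z : V} (h : y ≠ z) (o) (σ : Cfg V) :
    numActive (σ y) ≤ numActive (act z o σ y) := by
  rcases o with _ | o
  · simp [act_none_apply, h]
  · rw [act_some_apply]; simp only [h, if_false]
    split_ifs
    · exact numActive_add _
    · exact le_rfl

lemma add_ne_sleeping (a : SiteState) : addParticle a ≠ .sleeping := by
  cases a <;> simp [addParticle]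

lemma act_comm {y z : V} (h : y ≠ z) (o o') (σ : Cfg V) (hy : 1 ≤ numActive (σ y))
    (hz : 1 ≤ numActive (σ z)) :
    act y o' (act z o σ) = act z o (act y o' σ) := by
  obtain ⟨a, ha⟩ := active_of_numActive hy
  obtain ⟨b, hb⟩ := active_of_numActive hz
  have h' := h.symm
  funext x
  rcases o with _ | o <;> rcases o' with _ | o'
  · simp only [act_none_apply, ha, hb, numActive]
    by_cases hxy : x = y
    · subst hxy; simp [h, h', ha, hb, numActive]
    · by_cases hxz : x = z
      · subst hxz; simp [h, h', ha, hb, numActive]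
      · simp [hxy, hxz]
  · by_cases hxy : x = y
    · subst hxy; 
      simp only [act_none_apply, act_some_apply, ha, hb, numActive]
      simp [h, h', ha, hb, numActive]
    · by_cases hxz : x = z
      · subst hxz
        simp only [act_none_apply, act_some_apply, ha, hb, numActive]
        by_cases ho : o' = some x <;> rcases b with _ | b <;> simp [h, h', ha, hb, numActive, addParticle, ho]
      · simp only [act_none_apply, act_some_apply, ha, hb, numActive]
        simp [hxy, hxz, h, h', ha, numActive]
  · by_cases hxy : x = y
    · subst hxy; 
      simp only [act_none_apply, act_some_apply, ha, hb, numActive]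
      by_cases ho : o = some x <;> rcases a with _ | a <;> simp [h, h', ha, hb, numActive, addParticle, ho]
    · by_cases hxz : x = z
      · subst hxz
        simp only [act_none_apply, act_some_apply, ha, hb, numActive]
        simp [h, h', ha, hb, numActive]
      · simp only [act_none_apply, act_some_apply, ha, hb, numActive]
        simp [hxy, hxz, h, h', hb, numActive]
  · by_cases hxy : x = y
    · subst hxy; 
      simp only [act_some_apply, ha, hb, numActive]
      by_cases ho : o = some x <;> by_cases ho' : o' = some x <;>
        simp [h, h', ha, hb, numActive, addParticle, ho, ho']
    · by_cases hxz : x = z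
      · subst hxz
        simp only [act_some_apply, ha, hb, numActive]
        by_cases ho : o = some x <;> by_cases ho' : o' = some x <;>
          simp [h, h', ha, hb, numActive, addParticle, ho, ho']
      · simp only [act_some_apply, ha, hb, numActive]
        by_cases ho : o = some x <;> by_cases ho' : o' = some x <;>
          simp [h, h', hxy, hxz, ha, hb, numActive, addParticle, ho, ho']

/-- order on site states -/
def sle (a b : SiteState) : Prop := numActive a ≤ numActive b ∧ cnt a ≤ cnt b

lemma sle_add {a b : SiteState} (h : sle a b) : sle (addParticle a) (addParticle b) := by
  cases a <;> cases b <;> simp_all [sle, numActive, cnt, addParticle]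

lemma sle_self_add (a : SiteState) : sle a (addParticle a) := by
  cases a <;> simp [sle, numActive, cnt, addParticle]

lemma sle_refl (a : SiteState) : sle a a := ⟨le_rfl, le_rfl⟩

lemma act_mono {y : V} (o) {σ τ : Cfg V} (h : ∀ x, sle (σ x) (τ x)) (hy : 1 ≤ numActive (σ y)) (x : V) :
    sle (act y o σ x) (act y o τ x) := by
  obtain ⟨a, ha⟩ := active_of_numActive hy
  obtain ⟨b, hb⟩ := active_of_numActive (hy.trans (h y).1)
  have hab := (h y).1
  rw [ha, hb] at hab
  simp only [numActive] at hab
  rcases o with _ | o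
  · simp only [act_none_apply, ha, hb, numActive]
    by_cases hxy : x = y
    · subst hxy
      rcases a with _ | a <;> rcases b with _ | b <;> simp [ha, hb, sle, numActive, cnt] at hab ⊢ <;> try omega
    · simp [hxy, h x]
  · simp only [act_some_apply, ha, hb, numActive]
    have key : sle (if x = y then SiteState.active (a+1-1) else σ x) (if x = y then SiteState.active (b+1-1) else τ x) := by
      split_ifs
      · simp [sle, numActive, cnt]; omega
      · exact h x
    split_ifs at key ⊢
    all_goals first | exact sle_add key | exact key

end
end ARWP


open MeasureTheory ENNReal Filter Topology ARW
set_option linter.all false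
namespace ARWP
noncomputable section
open Finset
variable {V : Type} [Fintype V] [DecidableEq V]

/-- reward: a jump from `x` -/
def rew (x y : V) (o : Option (Option V)) : ℝ := if y = x ∧ o ≠ none then 1 else 0

lemma rew_nonneg (x y : V) (o) : 0 ≤ rew x y o := by unfold rew; split_ifs <;> norm_num

/-- linear potential -/
def Pot (g : V → ℝ) (σ : Cfg V) : ℝ := ∑ x, (cnt (σ x) : ℝ) * g x

lemma Pot_update (g : V → ℝ) (σ : Cfg V) (y : V) (a : SiteState) :
    Pot g (Function.update σ y a) = Pot g σ + ((cnt a : ℝ) - cnt (σ y)) * g y := by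
  unfold Pot
  rw [← Finset.add_sum_erase _ _ (Finset.mem_univ y), ← Finset.add_sum_erase univ _ (Finset.mem_univ y)]
  have : ∀ x ∈ univ.erase y, (cnt (Function.update σ y a x) : ℝ) * g x = cnt (σ x) * g x := by
    intro x hx
    rw [Function.update_of_ne (Finset.ne_of_mem_erase hx)]
  rw [Finset.sum_congr rfl this]
  simp only [Function.update_self]
  ring

lemma Pot_addO (g : V → ℝ) (σ : Cfg V) (z : V) : Pot g (addO (some z) σ) = Pot g σ + g z := by
  simp only [addO, Pot_update, cnt_add]; push_cast; ring

lemma Pot_act_none (g : V → ℝ) (σ : Cfg V) (y : V) : Pot g (act y none σ) = Pot g σ := by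
  simp only [act]
  split_ifs with h
  · obtain ⟨a, ha⟩ := active_of_numActive h.ge
    rw [Pot_update, ha]
    rw [ha] at h
    simp [numActive] at h
    simp [cnt, h]
  · rfl

lemma Pot_act_exit (g : V → ℝ) (σ : Cfg V) (y : V) (hy : 1 ≤ numActive (σ y)) :
    Pot g (act y (some none) σ) = Pot g σ - g y := by
  obtain ⟨a, ha⟩ := active_of_numActive hy
  simp only [act, addO, Pot_update, ha, numActive, cnt]
  push_cast; simp; ring

lemma Pot_act_jump (g : V → ℝ) (σ : Cfg V) (y z : V) (hy : 1 ≤ numActive (σ y)) :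
    Pot g (act y (some (some z)) σ) = Pot g σ - g y + g z := by
  obtain ⟨a, ha⟩ := active_of_numActive hy
  simp only [act, Pot_addO, Pot_update, ha, numActive, cnt]
  push_cast; simp; ring

lemma Pot_nonneg {g : V → ℝ} (hg : ∀ x, 0 ≤ g x) (σ : Cfg V) : 0 ≤ Pot g σ :=
  Finset.sum_nonneg fun x _ => mul_nonneg (Nat.cast_nonneg _) (hg x)

lemma Pot_mono {g h : V → ℝ} (hg : ∀ x, g x ≤ h x) (σ : Cfg V) : Pot g σ ≤ Pot h σ :=
  Finset.sum_le_sum fun x _ => mul_le_mul_of_nonneg_left (hg x) (Nat.cast_nonneg _)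

lemma le_Pot {g : V → ℝ} (hg : ∀ x, 0 ≤ g x) (σ : Cfg V) (y : V) (hy : 1 ≤ cnt (σ y)) :
    g y ≤ Pot g σ := by
  have h1 : (cnt (σ y) : ℝ) * g y ≤ Pot g σ :=
    Finset.single_le_sum (f := fun x => (cnt (σ x) : ℝ) * g x)
      (fun x _ => mul_nonneg (Nat.cast_nonneg _) (hg x)) (Finset.mem_univ y)
  have : (1:ℝ) ≤ cnt (σ y) := by exact_mod_cast hy
  nlinarith [hg y]

lemma cnt_of_numActive {a : SiteState} (h : 1 ≤ numActive a) : 1 ≤ cnt a := by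
  obtain ⟨n, rfl⟩ := active_of_numActive h; simp [cnt]

namespace Sys

lemma E_Pot (S : Sys V) (g : V → ℝ) (σ : Cfg V) (y : V) (hy : 1 ≤ numActive (σ y)) :
    S.E y (fun o => Pot g (act y o σ)) =
      Pot g σ + (1 - S.s) * (∑ z, S.p y z * g z - g y) := by
  rw [E_eq, Pot_act_none, Pot_act_exit _ _ _ hy]
  simp only [Pot_act_jump _ _ _ _ hy, mul_add, Finset.sum_add_distrib, ← Finset.sum_mul]
  ring

lemma E_rew (S : Sys V) (x y : V) : S.E y (rew x y) = if y = x then 1 - S.s else 0 := by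
  rw [E_eq]
  by_cases h : y = x
  · simp [rew, h]
  · simp [rew, h]

/-- value functions: maximal expected number of jumps from `x` in `n` topplings,
with legality thresholds `th` -/
def W (S : Sys V) (th : V → ℕ) (x : V) : ℕ → Cfg V → ℝ
  | 0, _ => 0
  | n + 1, σ => (univ : Finset (Option V)).sup' ⟨none, Finset.mem_univ _⟩ fun a =>
      match a with
      | none => 0
      | some y => if th y ≤ numActive (σ y) then
          S.E y (fun o => rew x y o + W S th x n (act y o σ)) else 0

variable (S : Sys V) (th : V → ℕ) (x : V)

lemma W_nonneg (n σ) : 0 ≤ S.W th x n σ := by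
  cases n with
  | zero => exact le_rfl
  | succ n =>
    rw [W]
    exact Finset.le_sup' (f := fun a : Option V => match a with
      | none => (0:ℝ)
      | some y => if th y ≤ numActive (σ y) then
          S.E y (fun o => rew x y o + W S th x n (act y o σ)) else 0) (Finset.mem_univ none)

lemma le_W (n : ℕ) (σ : Cfg V) (y : V) (hy : th y ≤ numActive (σ y)) :
    S.E y (fun o => rew x y o + S.W th x n (act y o σ)) ≤ S.W th x (n + 1) σ := by
  rw [W]
  have := Finset.le_sup' (f := fun a : Option V => match a with
      | none => (0:ℝ)
      | some y => if th y ≤ numActive (σ y) then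
          S.E y (fun o => rew x y o + W S th x n (act y o σ)) else 0) (Finset.mem_univ (some y))
  simp only [hy, if_true] at this
  exact this

lemma W_le (n : ℕ) (σ : Cfg V) (c : ℝ) (hc : 0 ≤ c)
    (h : ∀ y, th y ≤ numActive (σ y) →
      S.E y (fun o => rew x y o + S.W th x n (act y o σ)) ≤ c) :
    S.W th x (n + 1) σ ≤ c := by
  rw [W]
  refine Finset.sup'_le _ _ fun a _ => ?_
  rcases a with _ | y
  · exact hc
  · dsimp only
    split_ifs with hy
    · exact h y hy
    · exact hc

lemma W_mono_succ (n : ℕ) (σ : Cfg V) : S.W th x n σ ≤ S.W th x (n + 1) σ := by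
  induction n generalizing σ with
  | zero => exact S.W_nonneg th x _ _
  | succ n ih =>
    refine S.W_le th x n σ _ (S.W_nonneg th x _ _) fun y hy => ?_
    refine le_trans ?_ (S.le_W th x (n+1) σ y hy)
    exact S.E_mono fun o => by gcongr; exact ih _

lemma W_mono (σ : Cfg V) : Monotone fun n => S.W th x n σ :=
  monotone_nat_of_le_succ fun n => S.W_mono_succ th x n σ

variable {th}

lemma W_le_Pot (hth : ∀ y, 1 ≤ th y) {g : V → ℝ} (hg0 : ∀ y, 0 ≤ g y)
    (hg : ∀ y, (if y = x then 1 else 0) + ∑ z, S.p y z * g z ≤ g y) (n : ℕ) (σ : Cfg V) :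
    S.W th x n σ ≤ Pot g σ := by
  induction n generalizing σ with
  | zero => exact Pot_nonneg hg0 σ
  | succ n ih =>
    refine S.W_le th x n σ _ (Pot_nonneg hg0 σ) fun y hy => ?_
    have hy1 := (hth y).trans hy
    calc _ ≤ S.E y (fun o => rew x y o + Pot g (act y o σ)) :=
          S.E_mono fun o => by gcongr; exact ih _
      _ = (if y = x then 1 - S.s else 0) + (Pot g σ + (1 - S.s) * (∑ z, S.p y z * g z - g y)) := by
          rw [E_add, E_rew, E_Pot _ _ _ _ hy1]
      _ ≤ Pot g σ := by
          have := hg y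
          have h1 := S.hs1
          split_ifs at this ⊢ <;> nlinarith

lemma W_le_H (hth : ∀ y, 1 ≤ th y) (n : ℕ) (σ : Cfg V) : S.W th x n σ ≤ Pot S.H σ := by
  refine S.W_le_Pot x hth S.hH0 (fun y => ?_) n σ
  have := S.hH y
  split_ifs <;> linarith

/-- toppling an acceptable site first does not decrease the value -/
lemma W_acc (hth : ∀ y, 1 ≤ th y) (n : ℕ) (σ : Cfg V) (y : V) (hy : 1 ≤ numActive (σ y)) :
    S.W th x n σ ≤ S.E y (fun o => rew x y o + S.W th x n (act y o σ)) := by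
  induction n generalizing σ with
  | zero =>
    rw [W]
    calc (0:ℝ) = S.E y (fun _ => 0) := (S.E_const y 0).symm
      _ ≤ _ := S.E_mono fun o => by simpa [W] using rew_nonneg x y o
  | succ n ih =>
    refine S.W_le th x n σ _ ?_ fun z hz => ?_
    · calc (0:ℝ) = S.E y (fun _ => 0) := (S.E_const y 0).symm
        _ ≤ _ := S.E_mono fun o => add_nonneg (rew_nonneg x y o) (S.W_nonneg th x _ _)
    by_cases hzy : z = y
    · subst hzy
      exact S.E_mono fun o => by gcongr; exact S.W_mono_succ th x n _
    · have hz1 := (hth z).trans hz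
      calc _ ≤ S.E z (fun o => rew x z o + S.E y (fun o' => rew x y o' + S.W th x n (act y o' (act z o σ)))) :=
            S.E_mono fun o => by
              gcongr
              exact ih _ (hy.trans (numActive_act (Ne.symm hzy) o σ))
        _ = S.E z (fun o => S.E y (fun o' => rew x z o + (rew x y o' + S.W th x n (act y o' (act z o σ))))) := by
            congr 1; funext o
            rw [S.E_add y (fun _ => rew x z o), E_const]
        _ = S.E y (fun o' => S.E z (fun o => rew x z o + (rew x y o' + S.W th x n (act y o' (act z o σ))))) :=
            S.E_comm _ _ _
        _ = S.E y (fun o' => rew x y o' + S.E z (fun o => rew x z o + S.W th x n (act z o (act y o' σ)))) := by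
            congr 1; funext o'
            rw [← S.E_const z (rew x y o'), ← E_add]
            simp only [E_const]
            congr 1; funext o
            rw [act_comm (Ne.symm hzy) o o' σ hy hz1]; ring
        _ ≤ _ := S.E_mono fun o' => by
            gcongr
            exact S.le_W th x n _ z (hz.trans (numActive_act hzy o' σ))

lemma W_sle (hth : ∀ y, 1 ≤ th y) (n : ℕ) {σ τ : Cfg V} (h : ∀ y, sle (σ y) (τ y)) : S.W th x n σ ≤ S.W th x n τ := by
  induction n generalizing σ τ with
  | zero => exact le_rfl
  | succ n ih =>
    refine S.W_le th x n σ _ (S.W_nonneg th x _ _) fun y hy => ?_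
    refine le_trans ?_ (S.le_W th x n τ y (hy.trans (h y).1))
    exact S.E_mono fun o => by
      gcongr
      exact ih (act_mono o h ((hth y).trans hy))

/-- limiting value -/
def Winf (S : Sys V) (th : V → ℕ) (x : V) (σ : Cfg V) : ℝ := ⨆ n, S.W th x n σ

lemma bdd (hth : ∀ y, 1 ≤ th y) (σ : Cfg V) : BddAbove (Set.range fun n => S.W th x n σ) :=
  ⟨Pot S.H σ, by rintro _ ⟨n, rfl⟩; exact S.W_le_H x hth n σ⟩

lemma tendsto_W (hth : ∀ y, 1 ≤ th y) (σ : Cfg V) : Tendsto (fun n => S.W th x n σ) atTop (𝓝 (S.Winf th x σ)) :=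
  tendsto_atTop_ciSup (S.W_mono th x σ) (S.bdd x hth σ)

lemma W_le_Winf (hth : ∀ y, 1 ≤ th y) (n : ℕ) (σ : Cfg V) : S.W th x n σ ≤ S.Winf th x σ := le_ciSup (S.bdd x hth σ) n

lemma Winf_le (hth : ∀ y, 1 ≤ th y) {σ : Cfg V} {c : ℝ} (h : ∀ n, S.W th x n σ ≤ c) : S.Winf th x σ ≤ c := ciSup_le h

lemma Winf_nonneg (hth : ∀ y, 1 ≤ th y) (σ : Cfg V) : 0 ≤ S.Winf th x σ := (S.W_nonneg th x 0 σ).trans (S.W_le_Winf x hth 0 σ)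

lemma Winf_le_H (hth : ∀ y, 1 ≤ th y) (σ : Cfg V) : S.Winf th x σ ≤ Pot S.H σ := S.Winf_le x hth fun n => S.W_le_H x hth n σ

lemma Winf_sle (hth : ∀ y, 1 ≤ th y) {σ τ : Cfg V} (h : ∀ y, sle (σ y) (τ y)) : S.Winf th x σ ≤ S.Winf th x τ :=
  S.Winf_le x hth fun n => (S.W_sle x hth n h).trans (S.W_le_Winf x hth n τ)

lemma Winf_acc (hth : ∀ y, 1 ≤ th y) (σ : Cfg V) (y : V) (hy : 1 ≤ numActive (σ y)) :
    S.Winf th x σ ≤ S.E y (fun o => rew x y o + S.Winf th x (act y o σ)) :=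
  S.Winf_le x hth fun n => (S.W_acc x hth n σ y hy).trans
    (S.E_mono fun o => by gcongr; exact S.W_le_Winf x hth n _)

lemma Winf_eq (hth : ∀ y, 1 ≤ th y) (σ : Cfg V) (y : V) (hy : th y ≤ numActive (σ y)) :
    S.Winf th x σ = S.E y (fun o => rew x y o + S.Winf th x (act y o σ)) := by
  refine le_antisymm (S.Winf_acc x hth σ y ((hth y).trans hy)) ?_
  have h1 : Tendsto (fun n => S.E y (fun o => rew x y o + S.W th x n (act y o σ))) atTop
      (𝓝 (S.E y (fun o => rew x y o + S.Winf th x (act y o σ)))) := by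
    unfold E
    refine tendsto_finset_sum _ fun o _ => ?_
    exact ((S.tendsto_W x hth _).const_add _).const_mul _
  exact le_of_tendsto' h1 fun n => (S.le_W th x n σ y hy).trans (S.W_le_Winf x hth _ σ)

/-- same, with the reward integrated -/
lemma Winf_eq' (hth : ∀ y, 1 ≤ th y) (σ : Cfg V) (y : V) (hy : th y ≤ numActive (σ y)) :
    S.E y (fun o => S.Winf th x (act y o σ)) = S.Winf th x σ - if y = x then 1 - S.s else 0 := by
  rw [S.Winf_eq x hth σ y hy, E_add, E_rew]; ring

lemma Winf_stable (hth : ∀ y, 1 ≤ th y) (σ : Cfg V) (h : ∀ y, numActive (σ y) < th y) : S.Winf th x σ = 0 := by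
  refine le_antisymm (S.Winf_le x hth fun n => ?_) (S.Winf_nonneg x hth σ)
  cases n with
  | zero => exact le_rfl
  | succ n => exact S.W_le th x n σ _ le_rfl fun y hy => absurd hy (by simpa using h y)


/-- comparison principle -/
lemma comparison (f : V → ℝ) (hf : ∀ y, f y ≤ ∑ z, S.p y z * f z) (y : V) : f y ≤ 0 := by
  have hH1 : ∀ y, 1 ≤ S.H y := fun y => by
    have := S.hH y
    have : 0 ≤ ∑ z, S.p y z * S.H z := Finset.sum_nonneg fun z _ => mul_nonneg (S.hp y z) (S.hH0 z)
    linarith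
  set B : ℝ := ∑ z, S.H z with hB
  have hHB : ∀ y, S.H y ≤ B := fun y =>
    Finset.single_le_sum (f := S.H) (fun z _ => S.hH0 z) (Finset.mem_univ y)
  have hB1 : 1 ≤ B := (hH1 y).trans (hHB y)
  set C : ℝ := ∑ z, |f z|
  have key : ∀ n : ℕ, ∀ y, f y ≤ C * (1 - 1 / B) ^ n * S.H y := by
    intro n
    induction n with
    | zero =>
      intro y
      have h1 : f y ≤ C := (le_abs_self _).trans
        (Finset.single_le_sum (f := fun z => |f z|) (fun z _ => abs_nonneg _) (Finset.mem_univ y))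
      have h2 : 0 ≤ C := Finset.sum_nonneg fun z _ => abs_nonneg _
      simp
      nlinarith [hH1 y]
    | succ n ih =>
      intro y
      have hr : 0 ≤ 1 - 1 / B := by
        rw [sub_nonneg, div_le_one (by linarith)]; exact hB1
      have hc : 0 ≤ C * (1 - 1 / B) ^ n :=
        mul_nonneg (Finset.sum_nonneg fun z _ => abs_nonneg _) (pow_nonneg hr n)
      calc f y ≤ ∑ z, S.p y z * f z := hf y
        _ ≤ ∑ z, S.p y z * (C * (1 - 1 / B) ^ n * S.H z) :=
            Finset.sum_le_sum fun z _ => mul_le_mul_of_nonneg_left (ih z) (S.hp y z)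
        _ = C * (1 - 1 / B) ^ n * ∑ z, S.p y z * S.H z := by
            rw [Finset.mul_sum]; exact Finset.sum_congr rfl fun z _ => by ring
        _ ≤ C * (1 - 1 / B) ^ n * ((1 - 1 / B) * S.H y) := by
            refine mul_le_mul_of_nonneg_left ?_ hc
            have h3 : 1 / B * S.H y ≤ 1 := by
              rw [one_div, inv_mul_le_iff₀ (by linarith)]; simpa using hHB y
            have := S.hH y
            nlinarith
        _ = _ := by ring
  have hlim : Tendsto (fun n : ℕ => C * (1 - 1 / B) ^ n * S.H y) atTop (𝓝 (C * 0 * S.H y)) := by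
    refine Tendsto.mul_const _ (Tendsto.const_mul _ (tendsto_pow_atTop_nhds_zero_of_lt_one ?_ ?_))
    · rw [sub_nonneg, div_le_one (by linarith)]; exact hB1
    · have : 0 < 1 / B := by positivity
      linarith
  have := ge_of_tendsto' hlim fun n => key n y
  simpa using this

end Sys
end
end ARWP


open MeasureTheory ENNReal Filter Topology ARW
set_option linter.all false
namespace ARWP
noncomputable section
open Finset
variable {V : Type} [Fintype V] [DecidableEq V]

def allAct (η : V → ℕ) : Cfg V := fun y => .active (η y)

/-- thresholds for weak stabilization at `x` -/
def thw (x : V) : V → ℕ := fun y => if y = x then 2 else 1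
/-- thresholds for stabilization -/
def th1 : V → ℕ := fun _ => 1

lemma thw_pos (x : V) : ∀ y, 1 ≤ thw x y := fun y => by unfold thw; split_ifs <;> norm_num
lemma th1_pos : ∀ y : V, 1 ≤ th1 y := fun _ => le_rfl

lemma act_none_sle (y : V) (σ : Cfg V) (x : V) : sle (act y none σ x) (σ x) := by
  rw [act_none_apply]
  split_ifs with h
  · obtain ⟨rfl, h⟩ := h
    exact ⟨by simp [numActive], by simpa [cnt] using cnt_of_numActive h.ge⟩
  · exact sle_refl _

lemma act_some_add (y : V) (o : Option V) (η : V → ℕ) :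
    act y (some o) (addO (some y) (allAct η)) = addO o (allAct η) := by
  funext x
  rw [act_some_apply, addO_apply, addO_apply, addO_apply]
  by_cases h : x = y
  · subst h; simp [allAct, addParticle, numActive]
  · simp [h, Ne.symm h]

/-- adding a particle commutes with toppling elsewhere -/
lemma act_addO {x y : V} (h : y ≠ x) (o) (σ : Cfg V) :
    act y o (addO (some x) σ) = addO (some x) (act y o σ) := by
  have h' := h.symm
  funext w
  rcases o with _ | o
  · simp only [act_none_apply, addO_apply]
    by_cases hw : w = x
    · subst hw; simp [h, h']
    · by_cases hwy : w = y <;> simp [hw, hwy, h, h', Ne.symm hw]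
  · simp only [act_some_apply, addO_apply]
    by_cases hw : w = x
    · subst hw; by_cases ho : o = some w <;> simp [h, h', ho]
    · by_cases hwy : w = y <;> simp [hw, hwy, h, h', Ne.symm hw]

lemma act_some_addO_self {x : V} (o : Option V) (σ : Cfg V) (hx : 1 ≤ numActive (σ x)) :
    act x (some o) (addO (some x) σ) = addO (some x) (act x (some o) σ) := by
  obtain ⟨a, ha⟩ := active_of_numActive hx
  funext w
  simp only [act_some_apply, addO_apply]
  by_cases hw : w = x
  · subst hw; by_cases ho : o = some w <;> simp [ha, numActive, addParticle, ho]
  · simp [hw, Ne.symm hw]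

lemma act_none_of_two {x : V} (σ : Cfg V) (hx : 2 ≤ numActive (σ x)) : act x none σ = σ := by
  simp only [act]; rw [if_neg (by omega)]

lemma numActive_addO (x : V) (σ : Cfg V) : numActive (σ x) + 1 ≤ numActive (addO (some x) σ x) := by
  rw [addO_apply]; simp; cases σ x <;> simp [numActive, addParticle]

lemma numActive_addO_le (x y : V) (σ : Cfg V) : numActive (σ y) ≤ numActive (addO (some x) σ y) := by
  rw [addO_apply]; split_ifs; exact numActive_add _; exact le_rfl

namespace Sys
variable (S : Sys V)

/-- an extra active particle added to an all-active configuration contributes at most the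
Green's function -/
lemma extra {th : V → ℕ} (hth : ∀ y, 1 ≤ th y) (x : V) (g : V → ℝ)
    (hg : ∀ y, g y = (if y = x then 1 else 0) + ∑ z, S.p y z * g z) (η : V → ℕ) (y : V) :
    S.Winf th x (addO (some y) (allAct η)) - S.Winf th x (allAct η) ≤ g y := by
  set D : V → ℝ := fun y => S.Winf th x (addO (some y) (allAct η)) - S.Winf th x (allAct η) with hD
  have h1 : ∀ y, D y ≤ (if y = x then 1 else 0) + ∑ z, S.p y z * D z := by
    intro y
    have hy : 1 ≤ numActive (addO (some y) (allAct η) y) :=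
      le_trans (by omega) (numActive_addO y (allAct η))
    have h := S.Winf_acc x hth _ y hy
    rw [E_add, E_rew, E_eq] at h
    simp only [act_some_add] at h
    have h2 : S.Winf th x (act y none (addO (some y) (allAct η))) ≤
        S.Winf th x (addO (some y) (allAct η)) := S.Winf_sle x hth fun z => act_none_sle y _ z
    have h3 : ∑ z, S.p y z * S.Winf th x (addO (some z) (allAct η)) =
        ∑ z, S.p y z * D z + (∑ z, S.p y z) * S.Winf th x (allAct η) := by
      simp only [hD, mul_sub, Finset.sum_sub_distrib, Finset.sum_mul]; ring
    rw [h3] at h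
    have hs := S.hs; have hs1 := S.hs1
    simp only [addO] at h
    have h4 : (1 - S.s) * S.Winf th x (addO (some y) (allAct η)) ≤
       (1 - S.s) * ((if y = x then 1 else 0) + ∑ z, S.p y z * D z + S.Winf th x (allAct η)) := by
      have h5 := mul_le_mul_of_nonneg_left h2 hs.le
      simp only [addO] at h5 ⊢
      split_ifs at h ⊢ <;> nlinarith
    have h6 := le_of_mul_le_mul_left h4 (by linarith)
    simp only [hD] at h6 ⊢
    linarith
  have h2 := S.comparison (fun y => D y - g y) (fun y => by
    simp only [mul_sub, Finset.sum_sub_distrib]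
    have := h1 y; have := hg y
    linarith) y
  simp only [hD] at h2
  linarith

/-- expected final number of particles at `x` -/
def sx (x : V) (σ : Cfg V) : ℝ :=
  cnt (σ x) + ∑ y, S.p y x * S.Winf th1 y σ - S.Winf th1 x σ

lemma cnt_eq_Pot (x : V) (σ : Cfg V) : (cnt (σ x) : ℝ) = Pot (fun y => if y = x then 1 else 0) σ := by
  simp [Pot]

lemma E_sx (x : V) (σ : Cfg V) (y : V) (hy : 1 ≤ numActive (σ y)) :
    S.E y (fun o => S.sx x (act y o σ)) = S.sx x σ := by
  unfold sx
  rw [E_sub, E_add, E_sum]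
  simp only [cnt_eq_Pot, E_smul]
  rw [E_Pot _ _ _ _ hy]
  have h : ∀ z, S.E y (fun o => S.Winf th1 z (act y o σ)) = S.Winf th1 z σ - if y = z then 1 - S.s else 0 :=
    fun z => S.Winf_eq' z th1_pos σ y hy
  simp only [h]
  simp only [mul_sub, Finset.sum_sub_distrib]
  simp
  ring

lemma sx_stable (x : V) (σ : Cfg V) (h : ∀ y, numActive (σ y) = 0) : S.sx x σ = cnt (σ x) := by
  have h' : ∀ z, S.Winf th1 z σ = 0 := fun z => S.Winf_stable z th1_pos σ fun y => by simp [h, th1]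
  simp [sx, h']

/-- the extra number of jumps -/
def Nx (x : V) (σ : Cfg V) : ℝ := S.Winf (thw x) x (addO (some x) σ) - S.Winf (thw x) x σ

lemma Nx_nonneg (x : V) (σ : Cfg V) : 0 ≤ S.Nx x σ := by
  refine sub_nonneg.2 (S.Winf_sle x (thw_pos x) fun y => ?_)
  rw [addO_apply]; split_ifs
  · exact sle_self_add _
  · exact sle_refl _

/-- one-step bound -/
lemma step_bound (x : V) (σ : Cfg V) (hx : σ x ≠ .sleeping) :
    (S.sx x σ - S.s * S.Nx x σ ≤ 0) ∨
    ∃ y, 1 ≤ numActive (σ y) ∧ ∃ u : Option (Option V) → ℝ, (∀ o, u o = 0 ∨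
        (act y o σ x ≠ .sleeping ∧ u o = S.sx x (act y o σ) - S.s * S.Nx x (act y o σ))) ∧
      S.sx x σ - S.s * S.Nx x σ ≤ S.E y u := by
  have hs := S.hs; have hs1 := S.hs1
  by_cases h1 : ∃ y, y ≠ x ∧ 1 ≤ numActive (σ y)
  · right
    obtain ⟨y, hyx, hy⟩ := h1
    refine ⟨y, hy, fun o => S.sx x (act y o σ) - S.s * S.Nx x (act y o σ), fun o => Or.inr ⟨?_, rfl⟩, ?_⟩
    · rcases o with _ | o
      · rw [act_none_apply]; simp [Ne.symm hyx, hx]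
      · rw [act_some_apply]; simp only [Ne.symm hyx, if_false]
        split_ifs
        · exact add_ne_sleeping _
        · exact hx
    · rw [E_sub, E_sx _ _ _ _ hy, E_smul]
      unfold Nx
      have ht : thw x y = 1 := by simp [thw, hyx]
      have e1 := S.Winf_eq' x (thw_pos x) σ y (by rw [ht]; exact hy)
      have e2 := S.Winf_eq' x (thw_pos x) (addO (some x) σ) y
        (by rw [ht]; exact hy.trans (numActive_addO_le x y σ))
      simp only [act_addO hyx] at e2
      rw [E_sub, e1, e2]
      apply le_of_eq; ring
  · push Not at h1
    have h1' : ∀ y, y ≠ x → numActive (σ y) = 0 := fun y hy => by have := h1 y hy; omega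
    rcases hσ : σ x with k | _
    swap
    · exact absurd hσ hx
    rcases k with _ | _ | k
    · left
      have hst : ∀ y, numActive (σ y) = 0 := fun y => by
        by_cases hy : y = x
        · subst hy; simp [hσ, numActive]
        · exact h1' y hy
      rw [S.sx_stable x σ hst, hσ]
      have := S.Nx_nonneg x σ
      simp only [cnt]
      push_cast
      nlinarith
    · right
      have hx1 : numActive (σ x) = 1 := by rw [hσ]; rfl
      refine ⟨x, hx1.ge, fun o => match o with
        | none => 0
        | some o => S.sx x (act x (some o) σ) - S.s * S.Nx x (act x (some o) σ), fun o => ?_, ?_⟩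
      · rcases o with _ | o
        · exact Or.inl rfl
        · refine Or.inr ⟨?_, rfl⟩
          rw [act_some_apply]; simp only [if_true]
          split_ifs
          · exact add_ne_sleeping _
          · simp
      · have hsl : S.sx x (act x none σ) = 1 := by
          rw [S.sx_stable]
          · simp [act_none_apply, hx1, cnt]
          · intro y
            rw [act_none_apply]
            by_cases hy : y = x
            · rw [if_pos ⟨hy, hx1⟩]; rfl
            · simp [hy, h1' y hy]
        have e0 := S.E_sx x σ x hx1.ge
        rw [E_eq, hsl] at e0
        have eW : S.Winf (thw x) x σ = 0 := S.Winf_stable x (thw_pos x) σ fun y => by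
          by_cases hy : y = x
          · subst hy; simp [thw, hx1]
          · simp [thw, hy, h1' y hy]
        have h2 : 2 ≤ numActive (addO (some x) σ x) := by
          have := numActive_addO x σ; omega
        have e2 := S.Winf_eq' x (thw_pos x) (addO (some x) σ) x (by simpa [thw] using h2)
        rw [E_eq, act_none_of_two _ h2] at e2
        simp only [act_some_addO_self _ σ hx1.ge, if_true] at e2
        have hN : ∀ τ, S.Winf (thw x) x (addO (some x) τ) = S.Nx x τ + S.Winf (thw x) x τ :=
          fun τ => by unfold Nx; ring
        rw [hN σ, eW, add_zero] at e2
        have hge : (1 - ∑ z, S.p x z) * S.Nx x (act x (some none) σ) + ∑ z, S.p x z * S.Nx x (act x (some (some z)) σ)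
            ≤ (1 - ∑ z, S.p x z) * S.Winf (thw x) x (addO (some x) (act x (some none) σ)) + ∑ z, S.p x z * S.Winf (thw x) x (addO (some x) (act x (some (some z)) σ)) := by
          refine add_le_add (mul_le_mul_of_nonneg_left ?_ (by linarith [S.hp1 x]))
            (Finset.sum_le_sum fun z _ => mul_le_mul_of_nonneg_left ?_ (S.hp x z))
          · rw [hN]; linarith [S.Winf_nonneg x (thw_pos x) (act x (some none) σ)]
          · rw [hN]; linarith [S.Winf_nonneg x (thw_pos x) (act x (some (some z)) σ)]
        rw [E_eq]
        simp only [mul_sub, Finset.sum_sub_distrib]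
        set A := (1 - ∑ z, S.p x z) * S.Nx x (act x (some none) σ) + ∑ z, S.p x z * S.Nx x (act x (some (some z)) σ) with hA
        have hA0 : 0 ≤ A := add_nonneg (mul_nonneg (by linarith [S.hp1 x]) (S.Nx_nonneg _ _))
          (Finset.sum_nonneg fun z _ => mul_nonneg (S.hp x z) (S.Nx_nonneg _ _))
        have hsum : ∑ z, S.p x z * (S.s * S.Nx x (act x (some (some z)) σ)) = S.s * ∑ z, S.p x z * S.Nx x (act x (some (some z)) σ) := by
          rw [Finset.mul_sum]; exact Finset.sum_congr rfl fun z _ => by ring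
        rw [hsum]
        set B := (1 - ∑ z, S.p x z) * S.sx x (act x (some none) σ) + ∑ z, S.p x z * S.sx x (act x (some (some z)) σ) with hB
        have hNA : 1 + A ≤ S.Nx x σ := by
          have : (1 - S.s) * (1 + A) ≤ (1 - S.s) * S.Nx x σ := by nlinarith
          exact le_of_mul_le_mul_left this (by linarith)
        have goal' : S.sx x σ - S.s * S.Nx x σ ≤ (1 - S.s) * (B - S.s * A) := by
          nlinarith [mul_le_mul_of_nonneg_left hNA hs.le, mul_nonneg (mul_nonneg hs.le hs.le) hA0]
        refine goal'.trans (le_of_eq ?_)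
        rw [hB, hA]; ring_nf
    · right
      have hx2 : 2 ≤ numActive (σ x) := by rw [hσ]; simp [numActive]
      have hx1 : 1 ≤ numActive (σ x) := by omega
      refine ⟨x, hx1, fun o => S.sx x (act x o σ) - S.s * S.Nx x (act x o σ), fun o => Or.inr ⟨?_, rfl⟩, ?_⟩
      · rcases o with _ | o
        · rw [act_none_of_two _ hx2]; exact hx
        · rw [act_some_apply]; simp only [if_true]
          split_ifs
          · exact add_ne_sleeping _
          · simp
      · rw [E_sub, E_sx _ _ _ _ hx1, E_smul]
        unfold Nx
        have ht : thw x x = 2 := by simp [thw]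
        have h3 : 2 ≤ numActive (addO (some x) σ x) := hx2.trans (numActive_addO_le x x σ)
        have e1 := S.Winf_eq' x (thw_pos x) σ x (by rw [ht]; exact hx2)
        have e2 := S.Winf_eq' x (thw_pos x) (addO (some x) σ) x (by rw [ht]; exact h3)
        have e3 : ∀ o, act x o (addO (some x) σ) = addO (some x) (act x o σ) := by
          intro o
          rcases o with _ | o
          · rw [act_none_of_two _ hx2, act_none_of_two _ h3]
          · exact act_some_addO_self o σ hx1
        simp only [e3] at e2
        rw [E_sub, e1, e2]
        apply le_of_eq; ring

end Sys
end
end ARWP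


open MeasureTheory ENNReal Filter Topology ARW
set_option linter.all false
namespace ARWP
noncomputable section
open Finset
variable {V : Type} [Fintype V] [DecidableEq V]

def rewN (x y : V) (o : Option (Option V)) : ℕ := if y = x ∧ o ≠ none then 1 else 0

lemma rewN_cast (x y : V) (o) : (rewN x y o : ℝ) = rew x y o := by
  unfold rewN rew; split_ifs <;> simp

lemma Pot_one_act (σ : Cfg V) (y : V) (o) (hy : 1 ≤ numActive (σ y)) :
    Pot (fun _ => 1) (act y o σ) ≤ Pot (fun _ => 1) σ := by
  rcases o with _ | _ | z
  · rw [Pot_act_none]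
  · rw [Pot_act_exit _ _ _ hy]; linarith
  · rw [Pot_act_jump _ _ _ _ hy]; linarith

namespace Sys
variable (S : Sys V)

/-- time potential -/
def Psi (σ : Cfg V) : ℝ := Pot S.H σ / (1 - S.s)

lemma Psi_nonneg (σ : Cfg V) : 0 ≤ S.Psi σ :=
  div_nonneg (Pot_nonneg S.hH0 σ) (by linarith [S.hs1])

lemma E_Psi (σ : Cfg V) (y : V) (hy : 1 ≤ numActive (σ y)) :
    S.E y (fun o => S.Psi (act y o σ)) ≤ S.Psi σ - 1 := by
  have h1 : 0 < 1 - S.s := by linarith [S.hs1]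
  have : (fun o => S.Psi (act y o σ)) = fun o => (1 - S.s)⁻¹ * Pot S.H (act y o σ) := by
    funext o; unfold Psi; field_simp
  rw [this, E_smul, E_Pot _ _ _ _ hy]
  unfold Psi
  rw [div_eq_inv_mul, mul_add, ← mul_assoc, inv_mul_cancel₀ h1.ne']
  linarith [S.hH y]

def BM (M : ℝ) : ℝ := (∑ z, S.H z) * M / (1 - S.s) + 1

lemma BM_ge (M : ℝ) (hM : 0 ≤ M) : 1 ≤ S.BM M := by
  unfold BM
  have h1 : 0 < 1 - S.s := by linarith [S.hs1]
  have : 0 ≤ ∑ z, S.H z := Finset.sum_nonneg fun z _ => S.hH0 z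
  have : 0 ≤ (∑ z, S.H z) * M / (1 - S.s) := by positivity
  linarith

lemma Psi_le (M : ℝ) (σ : Cfg V) (h : Pot (fun _ => 1) σ ≤ M) : S.Psi σ ≤ S.BM M := by
  have h1 : 0 < 1 - S.s := by linarith [S.hs1]
  have hK : 0 ≤ ∑ z, S.H z := Finset.sum_nonneg fun z _ => S.hH0 z
  have h2 : Pot S.H σ ≤ (∑ z, S.H z) * Pot (fun _ => 1) σ := by
    unfold Pot
    rw [Finset.mul_sum]
    refine Finset.sum_le_sum fun x _ => ?_
    have := Finset.single_le_sum (f := S.H) (fun z _ => S.hH0 z) (Finset.mem_univ x)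
    have h0 : (0:ℝ) ≤ cnt (σ x) := Nat.cast_nonneg _
    nlinarith
  have h3 : Pot S.H σ ≤ (∑ z, S.H z) * M := h2.trans (mul_le_mul_of_nonneg_left h hK)
  unfold Psi BM
  have := div_le_div_of_nonneg_right h3 h1.le
  linarith

lemma contr (M : ℝ) (hM : 0 ≤ M) (σ : Cfg V) (h : Pot (fun _ => 1) σ ≤ M) :
    S.Psi σ - 1 ≤ (1 - 1 / S.BM M) * S.Psi σ := by
  have h1 := S.BM_ge M hM
  have h3 : 1 / S.BM M * S.Psi σ ≤ 1 := by
    rw [one_div, inv_mul_le_iff₀ (by linarith)]; simpa using S.Psi_le M σ h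
  linarith

lemma ratio_nonneg (M : ℝ) (hM : 0 ≤ M) : 0 ≤ 1 - 1 / S.BM M := by
  rw [sub_nonneg, div_le_one (by linarith [S.BM_ge M hM])]; exact S.BM_ge M hM

lemma ratio_lt (M : ℝ) (hM : 0 ≤ M) : 1 - 1 / S.BM M < 1 := by
  have := S.BM_ge M hM
  have : 0 < 1 / S.BM M := by positivity
  linarith

lemma Pot_H_eq (σ : Cfg V) : Pot S.H σ ≤ S.Psi σ := by
  unfold Psi
  rw [le_div_iff₀ (by linarith [S.hs1])]
  nlinarith [Pot_nonneg S.hH0 σ, S.hs]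

lemma H_ge_one (y : V) : 1 ≤ S.H y := by
  have := S.hH y
  have : 0 ≤ ∑ z, S.p y z * S.H z := Finset.sum_nonneg fun z _ => mul_nonneg (S.hp y z) (S.hH0 z)
  linarith

lemma p_le_one (y z : V) : S.p y z ≤ 1 :=
  (Finset.single_le_sum (f := S.p y) (fun z _ => S.hp y z) (Finset.mem_univ z)).trans (S.hp1 y)

/-- probability of a sleeping particle at `x` is bounded by the number of chances -/
lemma sx_le_Nx (x : V) (σ : Cfg V) (hx : σ x ≠ .sleeping) : S.sx x σ ≤ S.s * S.Nx x σ := by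
  set M : ℝ := Pot (fun _ => 1) σ with hM
  have hM0 : 0 ≤ M := Pot_nonneg (fun _ => zero_le_one) σ
  set C : ℝ := 1 + Fintype.card V
  have key : ∀ n : ℕ, ∀ τ : Cfg V, τ x ≠ .sleeping → Pot (fun _ => 1) τ ≤ M →
      S.sx x τ - S.s * S.Nx x τ ≤ C * (1 - 1 / S.BM M) ^ n * S.Psi τ := by
    intro n
    induction n with
    | zero =>
      intro τ _ _
      have h1 : (cnt (τ x) : ℝ) ≤ Pot S.H τ := by
        rw [cnt_eq_Pot]
        refine Pot_mono (fun y => ?_) τ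
        have := S.H_ge_one y
        split_ifs <;> linarith
      have h2 : ∑ y, S.p y x * S.Winf th1 y τ ≤ Fintype.card V * Pot S.H τ := by
        rw [← nsmul_eq_mul, ← Finset.card_univ, ← Finset.sum_const]
        refine Finset.sum_le_sum fun y _ => ?_
        have := S.Winf_le_H y th1_pos τ
        have := S.Winf_nonneg y th1_pos τ
        have := S.p_le_one y x
        have := S.hp y x
        nlinarith
      have h3 := S.Winf_nonneg x th1_pos τ
      have h4 := mul_nonneg S.hs.le (S.Nx_nonneg x τ)
      have h5 : C * Pot S.H τ ≤ C * S.Psi τ :=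
        mul_le_mul_of_nonneg_left (S.Pot_H_eq τ) (by positivity)
      simp only [pow_zero, mul_one]
      refine le_trans ?_ h5
      unfold sx
      simp only [C]
      linarith
    | succ n ih =>
      intro τ hτ hτM
      have ht : 0 ≤ C * (1 - 1 / S.BM M) ^ n :=
        mul_nonneg (by positivity) (pow_nonneg (S.ratio_nonneg M hM0) n)
      rcases S.step_bound x τ hτ with h | ⟨y, hy, u, hu, h⟩
      · refine h.trans ?_
        exact mul_nonneg (mul_nonneg (by positivity) (pow_nonneg (S.ratio_nonneg M hM0) _)) (S.Psi_nonneg τ)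
      · calc _ ≤ _ := h
          _ ≤ S.E y (fun o => C * (1 - 1 / S.BM M) ^ n * S.Psi (act y o τ)) := S.E_mono fun o => by
              rcases hu o with h0 | ⟨h1, h2⟩
              · rw [h0]; exact mul_nonneg ht (S.Psi_nonneg _)
              · rw [h2]; exact ih _ h1 ((Pot_one_act τ y o hy).trans hτM)
          _ ≤ C * (1 - 1 / S.BM M) ^ n * (S.Psi τ - 1) := by
              rw [E_smul]; exact mul_le_mul_of_nonneg_left (S.E_Psi τ y hy) ht
          _ ≤ C * (1 - 1 / S.BM M) ^ n * ((1 - 1 / S.BM M) * S.Psi τ) :=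
              mul_le_mul_of_nonneg_left (S.contr M hM0 τ hτM) ht
          _ = _ := by ring
  have hlim : Tendsto (fun n : ℕ => C * (1 - 1 / S.BM M) ^ n * S.Psi σ) atTop (𝓝 (C * 0 * S.Psi σ)) :=
    Tendsto.mul_const _ (Tendsto.const_mul _
      (tendsto_pow_atTop_nhds_zero_of_lt_one (S.ratio_nonneg M hM0) (S.ratio_lt M hM0)))
  have := ge_of_tendsto' hlim fun n => key n σ hx le_rfl
  simp at this
  linarith

/-- being a Green's function with target `x` -/
def IsGreen (x : V) (g : V → ℝ) : Prop := ∀ y, g y = (if y = x then 1 else 0) + ∑ z, S.p y z * g z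

lemma IsGreen.nonneg {x : V} {g : V → ℝ} (hg : S.IsGreen x g) (y : V) : 0 ≤ g y := by
  have := S.comparison (fun y => - g y) (fun y => by
    have := hg y
    simp only [mul_neg, Finset.sum_neg_distrib]
    split_ifs at this <;> linarith) y
  linarith

lemma IsGreen.le_self {x : V} {g : V → ℝ} (hg : S.IsGreen x g) (y : V) : g y ≤ g x := by
  have := S.comparison (fun y => max (g y - g x) 0) (fun y => by
    have h0 : 0 ≤ ∑ z, S.p y z * max (g z - g x) 0 :=
      Finset.sum_nonneg fun z _ => mul_nonneg (S.hp y z) (le_max_right _ _)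
    by_cases hy : y = x
    · subst hy; simpa using h0
    · refine max_le ?_ h0
      have h1 := hg y
      rw [if_neg hy] at h1
      have h2 : ∑ z, S.p y z * (g z - g x) ≤ ∑ z, S.p y z * max (g z - g x) 0 :=
        Finset.sum_le_sum fun z _ => mul_le_mul_of_nonneg_left (le_max_left _ _) (S.hp y z)
      simp only [mul_sub, Finset.sum_sub_distrib, ← Finset.sum_mul] at h2
      have h3 := S.hp1 y
      have h4 := hg.nonneg S x
      nlinarith) y
  have h2 := le_max_left (g y - g x) 0
  linarith

/-- lower bound for the expected number of jumps -/
lemma lower (ζ : ℝ) (G : V → V → ℝ) (hG : ∀ x, S.IsGreen x (G x)) (hζ : ∀ x, S.s * G x x ≤ ζ)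
    (o : V) (η : V → ℕ) :
    ∑ x, G o x * ((η x : ℝ) - ζ) ≤ S.Winf th1 o (allAct η) := by
  have h1 : ∀ x, S.sx x (allAct η) ≤ ζ := fun x => by
    refine (S.sx_le_Nx x _ (by simp [allAct])).trans (le_trans ?_ (hζ x))
    exact mul_le_mul_of_nonneg_left (S.extra (thw_pos x) x (G x) (hG x) η x) S.hs.le
  have h2 : ∑ x, G o x * ((η x : ℝ) - S.sx x (allAct η)) = S.Winf th1 o (allAct η) := by
    simp only [sx, allAct, cnt]
    have e1 : ∀ x, G o x * ((η x : ℝ) - (η x + ∑ y, S.p y x * S.Winf th1 y (allAct η) - S.Winf th1 x (allAct η)))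
       = G o x * S.Winf th1 x (allAct η) - ∑ y, S.Winf th1 y (allAct η) * (S.p y x * G o x) := fun x => by
      rw [show G o x * ((η x : ℝ) - (η x + ∑ y, S.p y x * S.Winf th1 y (allAct η) - S.Winf th1 x (allAct η))) =
        G o x * S.Winf th1 x (allAct η) - G o x * ∑ y, S.p y x * S.Winf th1 y (allAct η) by ring, Finset.mul_sum]
      congr 1
      exact Finset.sum_congr rfl fun y _ => by ring
    have e2 := Finset.sum_congr rfl fun x (_ : x ∈ univ) => e1 x
    refine Eq.trans e2 ?_
    rw [Finset.sum_sub_distrib, Finset.sum_comm]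
    simp only [← Finset.mul_sum]
    rw [← Finset.sum_sub_distrib]
    have e3 : ∀ x, G o x * S.Winf th1 x (allAct η) - S.Winf th1 x (allAct η) * ∑ z, S.p x z * G o z
        = if x = o then S.Winf th1 x (allAct η) else 0 := fun x => by
      have := hG o x
      split_ifs at this ⊢
      · linear_combination S.Winf th1 x (allAct η) * this
      · linear_combination S.Winf th1 x (allAct η) * this
    simp [e3]
  rw [← h2]
  exact Finset.sum_le_sum fun x _ => mul_le_mul_of_nonneg_left (by linarith [h1 x]) ((hG o).nonneg S x)

open scoped Classical in
/-- running a fixed strategy for `n` steps with payoff `f` of the number of jumps at `o` -/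
def ev (S : Sys V) (o : V) (f : ℕ → ℝ) : ℕ → Cfg V → ℕ → ℝ
  | 0, _, k => f k
  | n + 1, σ, k => if h : ∃ y, 1 ≤ numActive (σ y) then
      S.E h.choose (fun a => ev S o f n (act h.choose a σ) (k + rewN o h.choose a)) else f k

lemma ev_mono (o : V) {f f' : ℕ → ℝ} (h : ∀ k, f k ≤ f' k) (n : ℕ) (σ : Cfg V) (k : ℕ) :
    S.ev o f n σ k ≤ S.ev o f' n σ k := by
  induction n generalizing σ k with
  | zero => exact h k
  | succ n ih =>
    simp only [ev]
    split_ifs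
    · exact S.E_mono fun a => ih _ _
    · exact h k

lemma ev_const (o : V) (c : ℝ) (n : ℕ) (σ : Cfg V) (k : ℕ) : S.ev o (fun _ => c) n σ k = c := by
  induction n generalizing σ k with
  | zero => rfl
  | succ n ih =>
    simp only [ev]
    split_ifs
    · simp only [ih, E_const]
    · rfl

lemma ev_lin (o : V) (f f' : ℕ → ℝ) (a b c : ℝ) (n : ℕ) (σ : Cfg V) (k : ℕ) :
    S.ev o (fun k => a + b * f k + c * f' k) n σ k = a + b * S.ev o f n σ k + c * S.ev o f' n σ k := by
  induction n generalizing σ k with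
  | zero => rfl
  | succ n ih =>
    simp only [ev]
    split_ifs
    · simp only [ih, E_add, E_smul, E_const]
    · rfl

lemma ev_id (o : V) (M : ℝ) (hM0 : 0 ≤ M) (n : ℕ) (σ : Cfg V) (k : ℕ)
    (hσ : Pot (fun _ => 1) σ ≤ M) :
    k + S.Winf th1 o σ - (1 - 1 / S.BM M) ^ n * S.Psi σ ≤ S.ev o (fun k => (k : ℝ)) n σ k := by
  induction n generalizing σ k with
  | zero =>
    simp only [ev, pow_zero, one_mul]
    have := S.Winf_le_H o th1_pos σ
    have := S.Pot_H_eq σ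
    linarith
  | succ n ih =>
    have ht : 0 ≤ (1 - 1 / S.BM M) ^ n := pow_nonneg (S.ratio_nonneg M hM0) n
    simp only [ev]
    split_ifs with h
    · set y := h.choose
      have hy : 1 ≤ numActive (σ y) := h.choose_spec
      have h1 : S.E y (fun a => (((k + rewN o y a : ℕ) : ℝ) + S.Winf th1 o (act y a σ)
          - (1 - 1 / S.BM M) ^ n * S.Psi (act y a σ))) ≤
          S.E y (fun a => S.ev o (fun k => (k : ℝ)) n (act y a σ) (k + rewN o y a)) :=
        S.E_mono fun a => ih _ _ ((Pot_one_act σ y a hy).trans hσ)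
      refine le_trans ?_ h1
      push_cast
      simp only [rewN_cast]
      rw [E_sub, E_add, E_add, E_const, E_smul, S.Winf_eq' o th1_pos σ y hy]
      rw [show S.E y (fun a => rew o y a) = _ from S.E_rew o y]
      have h2 := mul_le_mul_of_nonneg_left ((S.E_Psi σ y hy).trans (S.contr M hM0 σ hσ)) ht
      rw [pow_succ]
      linarith
    · push Not at h
      have : S.Winf th1 o σ = 0 := S.Winf_stable o th1_pos σ h
      have h3 : 0 ≤ (1 - 1 / S.BM M) ^ (n+1) * S.Psi σ :=
        mul_nonneg (pow_nonneg (S.ratio_nonneg M hM0) _) (S.Psi_nonneg σ)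
      linarith

lemma ev_sq (o : V) {g : V → ℝ} (hg : S.IsGreen o g) (n : ℕ) (σ : Cfg V) (k : ℕ) :
    S.ev o (fun k => (k : ℝ) ^ 2) n σ k ≤
      (k + Pot g σ) ^ 2 + Pot (fun y => 2 * g o * g y - g y ^ 2) σ := by
  have hw0 : ∀ y, 0 ≤ 2 * g o * g y - g y ^ 2 := fun y => by
    nlinarith [hg.nonneg S y, hg.le_self S y]
  set w : V → ℝ := fun y => 2 * g o * g y - g y ^ 2 with hw
  have base : ∀ (σ : Cfg V) (k : ℕ), (k : ℝ) ^ 2 ≤ (k + Pot g σ) ^ 2 + Pot w σ := fun σ k => by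
    have h1 := Pot_nonneg (hg.nonneg S) σ
    have h2 := Pot_nonneg hw0 σ
    have h3 : (0:ℝ) ≤ k := Nat.cast_nonneg k
    nlinarith
  induction n generalizing σ k with
  | zero => exact base σ k
  | succ n ih =>
    simp only [ev]
    split_ifs with h
    · set y := h.choose
      have hy : 1 ≤ numActive (σ y) := h.choose_spec
      refine (S.E_mono fun a => ih (act y a σ) (k + rewN o y a)).trans ?_
      push_cast
      simp only [rewN_cast]
      rw [E_eq]
      simp only [Pot_act_none, Pot_act_exit _ _ _ hy, Pot_act_jump _ _ _ _ hy]
      set ind : ℝ := if y = o then 1 else 0 with hind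
      have r0 : rew o y none = 0 := by simp [rew]
      have r1 : ∀ a : Option V, rew o y (some a) = ind := fun a => by simp [rew, hind]
      simp only [r0, r1]
      set A : ℝ := k + Pot g σ with hA
      set c : ℝ := ind - g y with hc
      have hpg : ∑ z, S.p y z * g z = - c := by
        have := hg y; rw [hc, hind]; linarith
      have e1 : ∑ z, S.p y z * ((↑k + ind + (Pot g σ - g y + g z)) ^ 2 + (Pot w σ - w y + w z)) =
          (∑ z, S.p y z) * ((A + c) ^ 2 + Pot w σ - w y) + (2 * (A + c) + 2 * g o) * ∑ z, S.p y z * g z := by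
        rw [Finset.sum_mul, Finset.mul_sum, ← Finset.sum_add_distrib]
        refine Finset.sum_congr rfl fun z _ => ?_
        simp only [hw, hA, hc]
        ring
      rw [e1, hpg]
      have e2 : (k:ℝ) + 0 + Pot g σ = A := by rw [hA]; ring
      have e3 : (k:ℝ) + ind + (Pot g σ - g y) = A + c := by rw [hA, hc]; ring
      rw [e2, e3]
      have hs := S.hs; have hs1 := S.hs1
      have e4 : -c ^ 2 - w y - 2 * g o * c ≤ 0 := by
        simp only [hw, hc, hind]
        split_ifs with hyo
        · rw [hyo]; ring_nf; norm_num
        · ring_nf; exact le_rfl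
      have e5 : (1 - ∑ z, S.p y z) * ((A + c) ^ 2 + (Pot w σ - w y)) +
          ((∑ z, S.p y z) * ((A + c) ^ 2 + Pot w σ - w y) + (2 * (A + c) + 2 * g o) * -c)
          = A ^ 2 + Pot w σ + (-c ^ 2 - w y - 2 * g o * c) := by ring
      rw [e5]
      nlinarith
    · exact base σ k

/-- Abstract Paley-Zygmund estimate. -/
lemma main_abs (ζ : ℝ) (G : V → V → ℝ) (hG : ∀ x, S.IsGreen x (G x)) (hζ : ∀ x, S.s * G x x ≤ ζ)
    (o : V) (η : V → ℕ) (b r P : ℝ) (hb : 0 ≤ b) (hr : 0 < r)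
    (hP : ∀ n, S.ev o (fun k => if b - r ≤ (k : ℝ) then 1 else 0) n (allAct η) 0 ≤ P) :
    1 - ((∑ x, (η x : ℝ) * G o x) ^ 2 + 2 * G o o * (∑ x, (η x : ℝ) * G o x)
      - 2 * b * (∑ x, G o x * ((η x : ℝ) - ζ)) + b ^ 2) / r ^ 2 ≤ P := by
  set σ := allAct η
  set M : ℝ := Pot (fun _ => 1) σ with hM
  have hM0 : 0 ≤ M := Pot_nonneg (fun _ => zero_le_one) σ
  set X := ∑ x, (η x : ℝ) * G o x with hX
  have hPot : Pot (G o) σ = X := rfl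
  set Y := ∑ x, G o x * ((η x : ℝ) - ζ) with hY
  have key : ∀ n : ℕ, 1 - (X ^ 2 + 2 * G o o * X - 2 * b * (Y - (1 - 1 / S.BM M) ^ n * S.Psi σ) + b ^ 2) / r ^ 2 ≤ P := by
    intro n
    refine le_trans ?_ (hP n)
    have h1 : ∀ k : ℕ, (1 - b ^ 2 / r ^ 2) + (2 * b / r ^ 2) * (k : ℝ) + (- 1 / r ^ 2) * (k : ℝ) ^ 2 ≤
        if b - r ≤ (k : ℝ) then 1 else 0 := fun k => by
      have e : (1 - b ^ 2 / r ^ 2) + (2 * b / r ^ 2) * (k : ℝ) + (- 1 / r ^ 2) * (k : ℝ) ^ 2 =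
        1 - (b - k) ^ 2 / r ^ 2 := by field_simp; ring
      rw [e]
      split_ifs with hk
      · have : 0 ≤ (b - k) ^ 2 / r ^ 2 := by positivity
        linarith
      · push Not at hk
        have : 1 ≤ (b - k) ^ 2 / r ^ 2 := by
          rw [one_le_div (by positivity)]
          nlinarith
        linarith
    refine le_trans ?_ (S.ev_mono o h1 n σ 0)
    rw [S.ev_lin o (fun k => (k : ℝ)) (fun k => (k : ℝ) ^ 2)]
    have h2 := S.ev_id o M hM0 n σ 0 le_rfl
    have h3 := S.ev_sq o (hG o) n σ 0
    have h4 := S.lower ζ G hG hζ o η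
    have h5 : Pot (fun y => 2 * G o o * G o y - G o y ^ 2) σ ≤ 2 * G o o * X := by
      rw [← hPot]
      unfold Pot
      rw [Finset.mul_sum]
      refine Finset.sum_le_sum fun x _ => ?_
      have : (0:ℝ) ≤ cnt (σ x) := Nat.cast_nonneg _
      nlinarith [mul_nonneg this (sq_nonneg (G o x))]
    rw [hPot] at h3
    simp only [Nat.cast_zero, zero_add] at h2 h3
    have h6 : Y - (1 - 1 / S.BM M) ^ n * S.Psi σ ≤ S.ev o (fun k => (k : ℝ)) n σ 0 := by linarith
    have h7 : S.ev o (fun k => (k : ℝ) ^ 2) n σ 0 ≤ X ^ 2 + 2 * G o o * X := by linarith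
    have h8 : (2 * b / r ^ 2) * (Y - (1 - 1 / S.BM M) ^ n * S.Psi σ) ≤ (2 * b / r ^ 2) * S.ev o (fun k => (k : ℝ)) n σ 0 :=
      mul_le_mul_of_nonneg_left h6 (by positivity)
    have h9 : (1 / r ^ 2) * S.ev o (fun k => (k : ℝ) ^ 2) n σ 0 ≤ (1 / r ^ 2) * (X ^ 2 + 2 * G o o * X) :=
      mul_le_mul_of_nonneg_left h7 (by positivity)
    have e6 : 1 - (X ^ 2 + 2 * G o o * X - 2 * b * (Y - (1 - 1 / S.BM M) ^ n * S.Psi σ) + b ^ 2) / r ^ 2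
      = 1 - b ^ 2 / r ^ 2 + (2 * b / r ^ 2) * (Y - (1 - 1 / S.BM M) ^ n * S.Psi σ) - (1 / r ^ 2) * (X ^ 2 + 2 * G o o * X) := by
      ring
    rw [e6]
    have e7 : (-1 / r ^ 2) * S.ev o (fun k => (k : ℝ) ^ 2) n σ 0 = - ((1 / r ^ 2) * S.ev o (fun k => (k : ℝ) ^ 2) n σ 0) := by ring
    rw [e7]
    linarith
  have hlim : Tendsto (fun n : ℕ => 1 - (X ^ 2 + 2 * G o o * X - 2 * b * (Y - (1 - 1 / S.BM M) ^ n * S.Psi σ) + b ^ 2) / r ^ 2)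
      atTop (𝓝 (1 - (X ^ 2 + 2 * G o o * X - 2 * b * (Y - 0 * S.Psi σ) + b ^ 2) / r ^ 2)) := by
    have := (tendsto_pow_atTop_nhds_zero_of_lt_one (S.ratio_nonneg M hM0) (S.ratio_lt M hM0)).mul_const (S.Psi σ)
    exact ((((this.const_sub Y).const_mul (2 * b)).const_sub _).add_const _).div_const _ |>.const_sub 1
  have := le_of_tendsto' hlim key
  simpa using this

end Sys
end
end ARWP


open MeasureTheory ENNReal Filter Topology ARW

set_option linter.all false

namespace ARWP
noncomputable section

open Finset

lemma lamS_pos {lam : ℝ} (h : 0 < lam) : 0 < lamS lam := by unfold lamS; positivity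
lemma lamJ_pos {lam : ℝ} (h : 0 < lam) : 0 < lamJ lam := by unfold lamJ; positivity
lemma lamSJ {lam : ℝ} (h : 0 < lam) : lamS lam + lamJ lam = 1 := by
  unfold lamJ lamS; field_simp; ring

lemma tsum_opt {α : Type} (f : Option α → ℝ≥0∞) : ∑' o, f o = f none + ∑' a, f (some a) := by
  rw [← (Equiv.optionEquivSumPUnit.{0} α).symm.tsum_eq f, ENNReal.summable.tsum_sum ENNReal.summable]
  simp [add_comm]

lemma tsum_step {d : ℕ} {step : Site d → ℝ} (h0 : ∀ z, 0 ≤ step z) (h1 : HasSum step 1) :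
    ∑' z, ENNReal.ofReal (step z) = 1 := by
  rw [← ENNReal.ofReal_tsum_of_nonneg h0 h1.summable, h1.tsum_eq, ENNReal.ofReal_one]

lemma tsum_instr {d : ℕ} {step : Site d → ℝ} (h0 : ∀ z, 0 ≤ step z) (h1 : HasSum step 1)
    {lam : ℝ} (hl : 0 < lam) : ∑' v, instrWeight step lam v = 1 := by
  rw [tsum_opt]
  simp only [instrWeight]
  rw [ENNReal.tsum_mul_left, tsum_step h0 h1, mul_one, ← ENNReal.ofReal_add (lamS_pos hl).le (lamJ_pos hl).le, lamSJ hl,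
    ENNReal.ofReal_one]

lemma exists_stackLaw {d : ℕ} {step : Site d → ℝ} (h0 : ∀ z, 0 ≤ step z) (h1 : HasSum step 1)
    {lam : ℝ} (hl : 0 < lam) : ∃ μ, IsStackLaw d step lam μ := by
  let P : PMF (Instr d) := ⟨instrWeight step lam, by
    have := tsum_instr h0 h1 hl
    rw [← this]; exact ENNReal.summable.hasSum⟩
  refine ⟨Measure.infinitePi (fun _ : Site d × ℕ => P.toMeasure), inferInstance, fun F g => ?_⟩
  have : {I : Stacks d | ∀ i ∈ F, I i = g i} = Set.pi F (fun i => {g i}) := by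
    ext I; simp [Set.mem_pi]
  rw [this, Measure.infinitePi_pi]
  · refine Finset.prod_congr rfl fun i _ => ?_
    rw [PMF.toMeasure_apply_singleton _ _ (by trivial)]; rfl
  · intro i _; trivial

lemma stackLaw_spec {d : ℕ} {step : Site d → ℝ} (h0 : ∀ z, 0 ≤ step z) (h1 : HasSum step 1)
    {lam : ℝ} (hl : 0 < lam) : IsStackLaw d step lam (stackLaw d step lam) := by
  have h := exists_stackLaw h0 h1 hl
  unfold stackLaw
  rw [dif_pos h]; exact h.choose_spec

lemma measurable_coord {d : ℕ} (i : Site d × ℕ) (v : Instr d) : MeasurableSet {I : Stacks d | I i = v} := by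
  have h : MeasurableSet ({v} : Set (Instr d)) := trivial
  exact (measurable_pi_apply (X := fun _ : Site d × ℕ => Instr d) i) h

lemma measurable_legal {d : ℕ} (V : Finset (Site d)) (l : List (Site d)) : ∀ (s : State d),
    MeasurableSet {I : Stacks d | Legal V I s l} := by
  induction l with
  | nil => intro s; simp [Legal]
  | cons x l ih =>
    intro s
    have : {I : Stacks d | Legal V I s (x :: l)} =
        ⋃ v : Instr d, {I | I (x, s.2 x) = v} ∩ {I | x ∈ V ∧ 1 ≤ numActive (s.1 x) ∧
          Legal V I (topple V (fun _ => v) x s) l} := by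
      ext I
      simp only [Legal, Set.mem_setOf_eq, Set.mem_iUnion, Set.mem_inter_iff, exists_eq_left']
      rfl
    rw [this]
    refine MeasurableSet.iUnion fun v => (measurable_coord _ _).inter ?_
    by_cases h : x ∈ V ∧ 1 ≤ numActive (s.1 x)
    · simpa [h] using ih _
    · have : {I : Stacks d | x ∈ V ∧ 1 ≤ numActive (s.1 x) ∧
          Legal V I (topple V (fun _ => v) x s) l} = ∅ := by
        ext I; simp only [Set.mem_setOf_eq, Set.mem_empty_iff_false, iff_false]; tauto
      rw [this]; exact MeasurableSet.empty

/-- the origin can be toppled at least `k` times in `V` -/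
def Ev {d : ℕ} (V : Finset (Site d)) (s : State d) (c : ℕ) (K : ℝ) : Set (Stacks d) :=
  {I | ∃ l, Legal V I s l ∧ K ≤ ((c + l.count 0 : ℕ) : ℝ)}

lemma measurable_Ev {d : ℕ} (V : Finset (Site d)) (s : State d) (c : ℕ) (K : ℝ) :
    MeasurableSet (Ev V s c K) := by
  have : Ev V s c K = ⋃ l : List (Site d), {I | Legal V I s l} ∩ {I | K ≤ ((c + l.count 0 : ℕ) : ℝ)} := by
    ext I; simp [Ev]
  rw [this]
  exact MeasurableSet.iUnion fun l => (measurable_legal V l s).inter (MeasurableSet.const _)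

lemma measurable_odom {d : ℕ} (η : Site d → ℕ) (k : ℕ) :
    MeasurableSet {I : Stacks d | (k : ℕ∞) ≤ odom0 I η} := by
  rcases Nat.eq_zero_or_pos k with rfl | hk
  · simp
  have : {I : Stacks d | (k : ℕ∞) ≤ odom0 I η} = ⋃ V : Finset (Site d), Ev V (initState d V η) 0 k := by
    ext I
    simp only [Set.mem_setOf_eq, Set.mem_iUnion, Ev, odom0]
    constructor
    · intro h
      by_contra hc
      push Not at hc
      have : odom0 I η ≤ ((k - 1 : ℕ) : ℕ∞) := by
        unfold odom0
        refine iSup_le fun V => iSup_le fun l => iSup_le fun hl => ?_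
        have := hc V l hl
        have : 0 + l.count 0 < k := by exact_mod_cast this
        have : l.count 0 ≤ k - 1 := by omega
        exact_mod_cast this
      have := h.trans this
      have : k ≤ k - 1 := by exact_mod_cast this
      omega
    · rintro ⟨V, l, hl, h⟩
      have h : k ≤ l.count 0 := by have : k ≤ 0 + l.count 0 := by exact_mod_cast h
                                   omega
      refine le_trans ?_ (le_iSup_of_le V (le_iSup_of_le l (le_iSup_of_le hl le_rfl)))
      exact_mod_cast h
  rw [this]
  exact MeasurableSet.iUnion fun V => measurable_Ev _ _ _ _

lemma Ev_sub {d : ℕ} (V : Finset (Site d)) (η : Site d → ℕ) (K : ℝ) (k : ℕ) (h : (k : ℝ) ≤ K) :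
    Ev V (initState d V η) 0 K ⊆ {I : Stacks d | (k : ℕ∞) ≤ odom0 I η} := by
  rintro I ⟨l, hl, h'⟩
  have h : k ≤ l.count 0 := by have : k ≤ 0 + l.count 0 := by exact_mod_cast h.trans h'
                               omega
  show (k : ℕ∞) ≤ odom0 I η
  unfold odom0
  refine le_trans ?_ (le_iSup_of_le V (le_iSup_of_le l (le_iSup_of_le hl le_rfl)))
  exact_mod_cast h

end
end ARWP


open MeasureTheory ENNReal Filter Topology ARW

set_option linter.all false

namespace ARWP
noncomputable section

open Finset

variable {d : ℕ} (V : Finset (Site d))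

def out (x : Site d) : Instr d → Option (Option {x // x ∈ V})
  | none => none
  | some z => if h : x + z ∈ V then some (some ⟨x + z, h⟩) else some none

def proj (s : State d) : Cfg {x // x ∈ V} := fun y => s.1 y

lemma proj_topple (I : Stacks d) (y : {x // x ∈ V}) (s : State d) :
    proj V (topple V I y s) = act y (out V y (I ((y : Site d), s.2 y))) (proj V s) := by
  funext z
  unfold topple proj
  rcases hI : I ((y : Site d), s.2 y) with _ | v
  · simp only [hI, out, act]
    split_ifs with h
    · simp only [Function.update_apply, Subtype.ext_iff]
    · rfl
  · simp only [hI, out, act]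
    by_cases hv : (y : Site d) + v ∈ V
    · simp only [hv, dif_pos, if_true, addO, Function.update_apply, Subtype.ext_iff]
    · simp only [hv, if_false, addO, Function.update_apply, Subtype.ext_iff, dif_neg, not_false_eq_true]

lemma sum_out {step : Site d → ℝ} (h0 : ∀ z, 0 ≤ step z) (h1 : HasSum step 1)
    {lam : ℝ} (hl : 0 < lam) (S : Sys {x // x ∈ V}) (hs : S.s = lamS lam)
    (hp : ∀ x z, S.p x z = step ((z : Site d) - x)) (y : {x // x ∈ V})
    (F : Option (Option {x // x ∈ V}) → ℝ≥0∞) :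
    ∑ o, ENNReal.ofReal (S.wt y o) * F o = ∑' v, instrWeight step lam v * F (out V y v) := by
  have hj : 1 - S.s = lamJ lam := by rw [hs, ← lamSJ hl]; ring
  have hsplit : ∀ q : Site d → ℝ≥0∞, ∑' w, (if w ∈ V then q w else 0) = ∑ w : {x // x ∈ V}, q w := by
    intro q
    rw [tsum_eq_sum (s := V)]
    · rw [← Finset.sum_coe_sort V q |>.symm]
      refine Finset.sum_congr rfl fun w hw => by simp [hw]
    · intro w hw; simp [hw]
  have htot : ∑ w : {x // x ∈ V}, ENNReal.ofReal (S.p y w) +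
      ∑' w, (if w ∈ V then 0 else ENNReal.ofReal (step (w - y))) = 1 := by
    rw [← tsum_step h0 h1, ← (Equiv.subRight (y : Site d)).tsum_eq (fun z => ENNReal.ofReal (step z))]
    simp only [hp]
    rw [← hsplit (fun w => ENNReal.ofReal (step (w - y))), ← ENNReal.tsum_add]
    refine tsum_congr fun w => ?_
    by_cases hw : w ∈ V <;> simp [hw]
  have hexit : ∑' w, (if w ∈ V then 0 else ENNReal.ofReal (step (w - y))) =
      ENNReal.ofReal (1 - ∑ w, S.p y w) := by
    rw [ENNReal.ofReal_sub _ (Finset.sum_nonneg fun w _ => S.hp y w),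
      ENNReal.ofReal_sum_of_nonneg (fun w _ => S.hp y w), ENNReal.ofReal_one, ← htot,
      ENNReal.add_sub_cancel_left]
    exact (ENNReal.sum_lt_top.2 fun w _ => ENNReal.ofReal_lt_top).ne
  rw [tsum_opt, Fintype.sum_option, Fintype.sum_option]
  simp only [Sys.wt, instrWeight, hj, out]
  rw [hs]
  congr 1
  rw [← (Equiv.subRight (y : Site d)).tsum_eq]
  have : ∀ w : Site d, ENNReal.ofReal (lamJ lam) * ENNReal.ofReal (step ((Equiv.subRight (y : Site d)) w)) *
      F (if h : (y : Site d) + (Equiv.subRight (y : Site d)) w ∈ V then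
        some (some ⟨(y : Site d) + (Equiv.subRight (y : Site d)) w, h⟩) else some none) =
      ENNReal.ofReal (lamJ lam) * F (some none) * (if w ∈ V then 0 else ENNReal.ofReal (step (w - y))) +
      (if w ∈ V then ENNReal.ofReal (lamJ lam) * (ENNReal.ofReal (step (w - y)) *
        (if h : w ∈ V then F (some (some ⟨w, h⟩)) else 0)) else 0) := by
    intro w
    have e : (y : Site d) + (Equiv.subRight (y : Site d)) w = w := by simp
    simp only [e]
    by_cases hw : w ∈ V
    · simp [hw, mul_assoc]
    · simp [hw]; ring
  rw [tsum_congr this, ENNReal.tsum_add, ENNReal.tsum_mul_left, hexit, hsplit]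
  rw [ENNReal.ofReal_mul (lamJ_pos hl).le]
  congr 1
  · ring
  · refine Finset.sum_congr rfl fun w _ => ?_
    rw [ENNReal.ofReal_mul (lamJ_pos hl).le, hp]
    simp [mul_assoc]

lemma ofReal_E (S : Sys {x // x ∈ V}) (y : {x // x ∈ V}) (f : Option (Option {x // x ∈ V}) → ℝ)
    (hf : ∀ o, 0 ≤ f o) :
    ENNReal.ofReal (S.E y f) = ∑ o, ENNReal.ofReal (S.wt y o) * ENNReal.ofReal (f o) := by
  unfold Sys.E
  rw [ENNReal.ofReal_sum_of_nonneg (fun o _ => mul_nonneg (S.wt_nonneg y o) (hf o))]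
  refine Finset.sum_congr rfl fun o _ => ENNReal.ofReal_mul (S.wt_nonneg y o)

/-- cylinder -/
def Cyl (F : Finset (Site d × ℕ)) (g : Site d × ℕ → Instr d) : Set (Stacks d) := {I | ∀ i ∈ F, I i = g i}

lemma measurable_Cyl (F : Finset (Site d × ℕ)) (g : Site d × ℕ → Instr d) : MeasurableSet (Cyl F g) := by
  have : Cyl F g = ⋂ i ∈ F, {I : Stacks d | I i = g i} := by ext; simp [Cyl]
  rw [this]
  exact MeasurableSet.biInter (Finset.countable_toSet F) fun i _ => measurable_coord i _

lemma connect {step : Site d → ℝ} (h0 : ∀ z, 0 ≤ step z) (h1 : HasSum step 1)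
    {lam : ℝ} (hl : 0 < lam) (S : Sys {x // x ∈ V}) (hs : S.s = lamS lam)
    (hp : ∀ x z, S.p x z = step ((z : Site d) - x)) (hV : (0 : Site d) ∈ V) (K : ℝ) (n : ℕ) :
    ∀ (s : State d) (c : ℕ) (F : Finset (Site d × ℕ)) (g : Site d × ℕ → Instr d),
      (∀ i ∈ F, i.2 < s.2 i.1) →
      stackLaw d step lam (Cyl F g) *
        ENNReal.ofReal (S.ev ⟨0, hV⟩ (fun k => if K ≤ (k : ℝ) then 1 else 0) n (proj V s) c) ≤
      stackLaw d step lam (Cyl F g ∩ Ev V s c K) := by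
  have hbase : ∀ (s : State d) (c : ℕ) (F : Finset (Site d × ℕ)) (g : Site d × ℕ → Instr d),
      stackLaw d step lam (Cyl F g) *
        ENNReal.ofReal (if K ≤ (c : ℝ) then 1 else 0) ≤
      stackLaw d step lam (Cyl F g ∩ Ev V s c K) := by
    intro s c F g
    split_ifs with h
    · rw [ENNReal.ofReal_one, mul_one]
      refine measure_mono fun I hI => ⟨hI, [], trivial, by simpa using h⟩
    · simp
  induction n with
  | zero => intro s c F g _; exact hbase s c F g
  | succ n ih =>
    intro s c F g hF
    rw [Sys.ev]
    by_cases hy : ∃ y, 1 ≤ numActive (proj V s y)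
    swap
    · rw [dif_neg hy]; exact hbase s c F g
    rw [dif_pos hy]
    generalize hyy : hy.choose = y
    have hact : 1 ≤ numActive (s.1 y) := by rw [← hyy]; exact hy.choose_spec
    set μ := stackLaw d step lam with hμ
    have hspec := stackLaw_spec h0 h1 hl
    rw [← hμ] at hspec
    have hi0 : ((y : Site d), s.2 y) ∉ F := fun h => lt_irrefl _ (hF _ h)
    set i0 : Site d × ℕ := ((y : Site d), s.2 y) with hi0d
    have hcyl : ∀ v, Cyl (insert i0 F) (Function.update g i0 v) = Cyl F g ∩ {I | I i0 = v} := by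
      intro v
      ext I
      simp only [Cyl, Finset.mem_insert, forall_eq_or_imp, Set.mem_setOf_eq, Set.mem_inter_iff,
        Function.update_self]
      rw [and_comm]
      refine and_congr_left fun _ => forall₂_congr fun i hi => ?_
      rw [Function.update_of_ne (show i ≠ i0 from fun h => hi0 (h ▸ hi))]
    have hμcyl : ∀ v, μ (Cyl (insert i0 F) (Function.update g i0 v)) = μ (Cyl F g) * instrWeight step lam v := by
      intro v
      unfold Cyl
      rw [hspec.2, hspec.2, Finset.prod_insert hi0, Function.update_self, mul_comm]
      congr 1
      refine Finset.prod_congr rfl fun i hi => ?_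
      rw [Function.update_of_ne (show i ≠ i0 from fun h => hi0 (h ▸ hi))]
    have hnn : ∀ σ k, 0 ≤ S.ev ⟨0, hV⟩ (fun k => if K ≤ (k : ℝ) then 1 else 0) n σ k := by
      intro σ k
      refine (S.ev_const ⟨0, hV⟩ 0 n σ k).symm.le.trans ?_
      exact S.ev_mono _ (fun k => by split_ifs <;> norm_num) n σ k
    rw [ofReal_E V S y _ (fun o => hnn _ _), sum_out V h0 h1 hl S hs hp y
      (fun o => ENNReal.ofReal (S.ev ⟨0, hV⟩ (fun k => if K ≤ (k : ℝ) then 1 else 0) n (act y o (proj V s))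
        (c + rewN ⟨0, hV⟩ y o))), ← ENNReal.tsum_mul_left]
    have hdec : Cyl F g ∩ Ev V s c K = ⋃ v, (Cyl F g ∩ Ev V s c K) ∩ {I | I i0 = v} := by
      ext I; simp
    rw [hdec, measure_iUnion]
    rotate_left
    · intro v w hvw
      refine Set.disjoint_left.2 fun I h h' => hvw ?_
      exact h.2.symm.trans h'.2
    · intro v
      exact ((measurable_Cyl F g).inter (measurable_Ev _ _ _ _)).inter (measurable_coord _ _)
    refine ENNReal.tsum_le_tsum fun v => ?_
    have hpv := proj_topple V (fun _ => v) y s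
    rw [← mul_assoc, ← hμcyl, ← hpv]
    refine (ih (topple V (fun _ => v) y s) _ _ _ ?_).trans (measure_mono ?_)
    · intro i hi
      simp only [topple]
      rcases Finset.mem_insert.1 hi with rfl | hi
      · simp [hi0d]
      · have := hF i hi
        rw [Function.update_apply]
        split_ifs with he
        · rw [he] at this; omega
        · exact this
    · rw [hcyl]
      rintro I ⟨⟨hI, hIv⟩, l, hlg, hk⟩
      refine ⟨⟨hI, (y : Site d) :: l, ⟨y.2, hact, ?_⟩, hk.trans ?_⟩, hIv⟩
      · have : topple V I y s = topple V (fun _ => v) y s := by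
          unfold topple
          have : I ((y : Site d), s.2 y) = v := hIv
          simp only [this]
        rw [this]; exact hlg
      · rw [List.count_cons]
        have : rewN ⟨0, hV⟩ y (out V y v) ≤ if (y : Site d) == 0 then 1 else 0 := by
          unfold rewN
          by_cases h : y = ⟨0, hV⟩
          · have : (y : Site d) = 0 := by rw [h]
            simp only [this, beq_self_eq_true, if_true]
            split_ifs <;> norm_num
          · simp [h]
        exact_mod_cast (by omega)

lemma connect0 {step : Site d → ℝ} (h0 : ∀ z, 0 ≤ step z) (h1 : HasSum step 1)
    {lam : ℝ} (hl : 0 < lam) (S : Sys {x // x ∈ V}) (hs : S.s = lamS lam)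
    (hp : ∀ x z, S.p x z = step ((z : Site d) - x)) (hV : (0 : Site d) ∈ V) (K : ℝ) (n : ℕ)
    (η : Site d → ℕ) :
      ENNReal.ofReal (S.ev ⟨0, hV⟩ (fun k => if K ≤ (k : ℝ) then 1 else 0) n (allAct fun x => η x) 0) ≤
      stackLaw d step lam (Ev V (initState d V η) 0 K) := by
  have hh := connect V h0 h1 hl S hs hp hV K n (initState d V η) 0 ∅ (fun _ => none) (by simp)
  have hc : Cyl (∅ : Finset (Site d × ℕ)) (fun _ => none) = Set.univ := by ext; simp [Cyl]
  have hspec := stackLaw_spec h0 h1 hl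
  haveI := hspec.1
  rw [hc, measure_univ, one_mul, Set.univ_inter] at hh
  convert hh using 4
  funext x
  simp [allAct, proj, initState]

end
end ARWP


open MeasureTheory ENNReal Filter Topology ARW

set_option linter.all false

namespace ARWP
noncomputable section

open Finset

namespace Sys
variable {V : Type} [Fintype V] [DecidableEq V] (S : Sys V)

lemma exists_green (x : V) : ∃ g, S.IsGreen x g := by
  let L : (V → ℝ) →ₗ[ℝ] (V → ℝ) :=
    { toFun := fun f y => f y - ∑ z, S.p y z * f z
      map_add' := fun f g => by
        funext y; simp only [Pi.add_apply, mul_add, Finset.sum_add_distrib]; ring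
      map_smul' := fun c f => by
        funext y
        simp only [Pi.smul_apply, smul_eq_mul, RingHom.id_apply, mul_sub, Finset.mul_sum]
        congr 1
        exact Finset.sum_congr rfl fun z _ => by ring }
  have hinj : Function.Injective L := by
    rw [← LinearMap.ker_eq_bot, LinearMap.ker_eq_bot']
    intro f hf
    have hf' : ∀ y, f y = ∑ z, S.p y z * f z := fun y => by
      have := congrFun hf y
      simp only [L, LinearMap.coe_mk, AddHom.coe_mk, Pi.zero_apply] at this
      linarith
    funext y
    refine le_antisymm (S.comparison f (fun y => (hf' y).le) y) ?_
    have := S.comparison (fun y => - f y) (fun y => by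
      simp only [mul_neg, Finset.sum_neg_distrib]; exact (neg_le_neg (hf' y).ge)) y
    simp only [Pi.zero_apply]; linarith
  obtain ⟨g, hg⟩ := (LinearMap.injective_iff_surjective.1 hinj) (fun y => if y = x then 1 else 0)
  refine ⟨g, fun y => ?_⟩
  have := congrFun hg y
  simp only [L, LinearMap.coe_mk, AddHom.coe_mk] at this
  linarith

def pw (x : V) : ℕ → V → ℝ
  | 0, y => if y = x then 1 else 0
  | k + 1, y => ∑ z, S.p y z * pw x k z

lemma pw_nonneg (x : V) (k : ℕ) (y : V) : 0 ≤ S.pw x k y := by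
  induction k generalizing y with
  | zero => simp only [pw]; split_ifs <;> norm_num
  | succ k ih => exact Finset.sum_nonneg fun z _ => mul_nonneg (S.hp y z) (ih z)

lemma pw_sum_succ (x : V) (K : ℕ) (y : V) : ∑ k ∈ range (K + 1), S.pw x k y =
    (if y = x then 1 else 0) + ∑ z, S.p y z * ∑ k ∈ range K, S.pw x k z := by
  rw [Finset.sum_range_succ', add_comm]
  congr 1
  simp only [pw, Finset.mul_sum]
  rw [Finset.sum_comm]

lemma pw_sum_le {x : V} {g : V → ℝ} (hg : S.IsGreen x g) (K : ℕ) (y : V) :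
    ∑ k ∈ range K, S.pw x k y ≤ g y := by
  induction K generalizing y with
  | zero => simpa using hg.nonneg S y
  | succ K ih =>
    rw [pw_sum_succ, hg y]
    have : ∑ z, S.p y z * ∑ k ∈ range K, S.pw x k z ≤ ∑ z, S.p y z * g z :=
      Finset.sum_le_sum fun z _ => mul_le_mul_of_nonneg_left (ih z) (S.hp y z)
    linarith

lemma green_le {x : V} {g : V → ℝ} (hg : S.IsGreen x g) (C : ℝ)
    (hC : ∀ K, ∑ k ∈ range K, S.pw x k x ≤ C) : g x ≤ C := by
  have hmono : ∀ y, Monotone fun K => ∑ k ∈ range K, S.pw x k y := fun y =>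
    monotone_nat_of_le_succ fun K => by
      rw [Finset.sum_range_succ]; linarith [S.pw_nonneg x K y]
  have hlim : ∀ y, ∃ l, Tendsto (fun K => ∑ k ∈ range K, S.pw x k y) atTop (𝓝 l) := fun y =>
    ⟨_, tendsto_atTop_ciSup (hmono y) ⟨g y, by rintro _ ⟨K, rfl⟩; exact S.pw_sum_le hg K y⟩⟩
  choose l hl using hlim
  have heq : ∀ y, l y = (if y = x then 1 else 0) + ∑ z, S.p y z * l z := by
    intro y
    have h1 := (hl y).comp (tendsto_add_atTop_nat 1)
    have h2 : Tendsto (fun K => (if y = x then (1:ℝ) else 0) + ∑ z, S.p y z * ∑ k ∈ range K, S.pw x k z) atTop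
        (𝓝 ((if y = x then 1 else 0) + ∑ z, S.p y z * l z)) :=
      tendsto_const_nhds.add (tendsto_finsetSum _ fun z _ => (hl z).const_mul _)
    refine tendsto_nhds_unique h1 (h2.congr fun K => ?_)
    rw [← pw_sum_succ]; rfl
  have h := S.comparison (fun y => g y - l y) (fun y => by
    rw [hg y, heq y]
    simp only [mul_sub, Finset.sum_sub_distrib]
    linarith) x
  have : l x ≤ C := le_of_tendsto (hl x) (Eventually.of_forall hC)
  linarith

end Sys

end
end ARWP


open MeasureTheory ENNReal Filter Topology ARW

set_option linter.all false

namespace ARWP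
noncomputable section

open Finset

variable {d : ℕ}

lemma sum_shift_le {step : Site d → ℝ} (h0 : ∀ z, 0 ≤ step z) (h1 : HasSum step 1) (V : Finset (Site d)) (y : Site d) :
    ∑ z : {x // x ∈ V}, step ((z : Site d) - y) ≤ 1 := by
  rw [Finset.sum_coe_sort V (fun z => step (z - y))]
  rw [← Finset.sum_image (s := V) (g := fun z => z - y) (f := step) (fun a _ b _ h => by simpa using h)]
  exact sum_le_hasSum _ (fun z _ => h0 z) h1

lemma sum_shift_le' {step : Site d → ℝ} (h0 : ∀ z, 0 ≤ step z) (h1 : HasSum step 1) (V : Finset (Site d)) (y z0 : Site d)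
    (h : y + z0 ∉ V) :
    ∑ z : {x // x ∈ V}, step ((z : Site d) - y) ≤ 1 - step z0 := by
  rw [Finset.sum_coe_sort V (fun z => step (z - y))]
  rw [← Finset.sum_image (s := V) (g := fun z => z - y) (f := step) (fun a _ b _ h => by simpa using h)]
  have hn : z0 ∉ V.image (fun z => z - y) := by
    intro hm
    obtain ⟨z, hz, rfl⟩ := Finset.mem_image.1 hm
    exact h (by simpa using hz)
  have := sum_le_hasSum (insert z0 (V.image (fun z => z - y))) (fun z _ => h0 z) h1
  rw [Finset.sum_insert hn] at this
  linarith

lemma exists_H {step : Site d → ℝ} (h0 : ∀ z, 0 ≤ step z) (h1 : HasSum step 1) (V : Finset (Site d))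
    {z0 : Site d} (hz : z0 ≠ 0) (ha : 0 < step z0) :
    ∃ H : {x // x ∈ V} → ℝ, (∀ y : {x // x ∈ V}, 1 + ∑ z : {x // x ∈ V}, step ((z : Site d) - y) * H z ≤ H y) ∧ ∀ y, 0 ≤ H y := by
  set a := step z0 with had
  have ha1 : a ≤ 1 := by simpa using sum_le_hasSum {z0} (fun z _ => h0 z) h1
  obtain ⟨i, hi⟩ : ∃ i, z0 i ≠ 0 := by
    by_contra hc; push Not at hc; exact hz (funext hc)
  obtain ⟨φ, hφ⟩ : ∃ φ : Site d → ℤ, ∀ y, φ y + 1 ≤ φ (y + z0) := by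
    rcases lt_or_gt_of_ne hi with h | h
    · exact ⟨fun y => - y i, fun y => by simp only [Pi.add_apply]; omega⟩
    · exact ⟨fun y => y i, fun y => by simp only [Pi.add_apply]; omega⟩
  set m : ℤ := ∑ y ∈ V, |φ y| with hm
  have hmφ : ∀ y ∈ V, |φ y| ≤ m := fun y hy =>
    Finset.single_le_sum (f := fun y => |φ y|) (fun z _ => abs_nonneg _) hy
  set n : Site d → ℕ := fun y => (φ y + m).toNat with hn
  set N : ℕ := (2 * m).toNat with hN
  have hnN : ∀ y ∈ V, n y ≤ N := fun y hy => by
    have := abs_le.1 (hmφ y hy); simp only [hn, hN]; omega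
  have hstep : ∀ y ∈ V, y + z0 ∈ V → n y + 1 ≤ n (y + z0) := fun y hy hy' => by
    have := abs_le.1 (hmφ y hy); have := hφ y; simp only [hn]; omega
  set R : ℝ := 2 / a with hR
  have hR1 : 1 ≤ R := by rw [hR, le_div_iff₀ ha]; linarith
  set C : ℝ := (1 + R ^ N) / a with hC
  have hCa : C * a = 1 + R ^ N := by rw [hC]; field_simp
  have hC0 : R ^ N ≤ C := by
    rw [hC, le_div_iff₀ ha]
    have : 0 ≤ R ^ N := by positivity
    nlinarith
  have hpow : ∀ y ∈ V, R ^ n y ≤ R ^ N := fun y hy => pow_le_pow_right₀ hR1 (hnN y hy)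
  have hpos : ∀ y, 0 < R ^ n y := fun y => by positivity
  have hCpos : 0 ≤ C := (by positivity : (0:ℝ) ≤ R ^ N).trans hC0
  refine ⟨fun y => C - R ^ n y, fun y => ?_, fun y => by linarith [hpow y y.2]⟩
  have hexp : ∑ z : {x // x ∈ V}, step ((z : Site d) - y) * (C - R ^ n z) =
      C * ∑ z : {x // x ∈ V}, step ((z : Site d) - y) - ∑ z : {x // x ∈ V}, step ((z : Site d) - y) * R ^ n z := by
    rw [Finset.mul_sum, ← Finset.sum_sub_distrib]
    exact Finset.sum_congr rfl fun z _ => by ring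
  show 1 + ∑ z : {x // x ∈ V}, step ((z : Site d) - y) * (C - R ^ n z) ≤ C - R ^ n y
  rw [hexp]
  by_cases hy : (y : Site d) + z0 ∈ V
  · have e1 := mul_le_mul_of_nonneg_left (sum_shift_le h0 h1 V y) hCpos
    have e2 : a * R ^ n (y + z0) ≤ ∑ z : {x // x ∈ V}, step ((z : Site d) - y) * R ^ n z := by
      have := Finset.single_le_sum (f := fun z : {x // x ∈ V} => step ((z : Site d) - y) * R ^ n z)
        (fun z _ => mul_nonneg (h0 _) (hpos _).le) (Finset.mem_univ ⟨_, hy⟩)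
      simpa using this
    have e3 : R ^ (n y + 1) ≤ R ^ n (y + z0) := pow_le_pow_right₀ hR1 (hstep y y.2 hy)
    have e4 : a * R ^ (n y + 1) = 2 * R ^ n y := by rw [pow_succ, hR]; field_simp
    have e5 : 1 ≤ R ^ n y := one_le_pow₀ hR1
    have e6 := mul_le_mul_of_nonneg_left e3 ha.le
    linarith
  · have e1 := mul_le_mul_of_nonneg_left (sum_shift_le' h0 h1 V y z0 hy) hCpos
    have e2 : 0 ≤ ∑ z : {x // x ∈ V}, step ((z : Site d) - y) * R ^ n z :=
      Finset.sum_nonneg fun z _ => mul_nonneg (h0 _) (hpos _).le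
    have e3 := hpow y y.2
    rw [← had, mul_sub, hCa] at e1
    linarith

/-- the n-step transition probabilities -/
def Qe (step : Site d → ℝ) : ℕ → Site d → ℝ≥0∞
  | 0, v => if v = 0 then 1 else 0
  | n + 1, v => ∑' u, ENNReal.ofReal (step u) * Qe step n (v - u)

lemma Qe_le_one {step : Site d → ℝ} (h0 : ∀ z, 0 ≤ step z) (h1 : HasSum step 1) (n : ℕ) (v : Site d) :
    Qe step n v ≤ 1 := by
  induction n generalizing v with
  | zero => simp only [Qe]; split_ifs <;> simp
  | succ n ih =>
    rw [← tsum_step h0 h1]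
    exact ENNReal.tsum_le_tsum fun u => (mul_le_mul_right (ih _) _).trans (mul_one _).le

lemma Qe_eq (step : Site d → ℝ) (n : ℕ) (v : Site d) :
    ∑' w : Fin n → Site d, (if ∑ i, w i = v then ∏ i, ENNReal.ofReal (step (w i)) else 0) = Qe step n v := by
  induction n generalizing v with
  | zero => simp [Qe, eq_comm]
  | succ n ih =>
    rw [← (Fin.consEquiv (fun _ : Fin (n + 1) => Site d)).tsum_eq, ENNReal.tsum_prod', Qe]
    refine tsum_congr fun u => ?_
    rw [← ih, ← ENNReal.tsum_mul_left]
    refine tsum_congr fun w => ?_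
    simp only [Fin.consEquiv_apply, Fin.sum_univ_succ, Fin.prod_univ_succ, Fin.cons_zero, Fin.cons_succ]
    have : (u + ∑ i, w i = v) ↔ (∑ i, w i = v - u) := by rw [eq_sub_iff_add_eq']
    simp only [this, mul_ite, mul_zero]

lemma probAt0_eq {step : Site d → ℝ} (h0 : ∀ z, 0 ≤ step z) (h1 : HasSum step 1) (n : ℕ) :
    ENNReal.ofReal (probAt0 step n) = Qe step n 0 := by
  have hps : ∀ w : Fin n → Site d, psum w n = ∑ i, w i := by
    intro w; unfold psum
    rw [Finset.filter_true_of_mem fun i _ => i.2]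
  have hne : Qe step n 0 ≠ ⊤ := ((Qe_le_one h0 h1 n 0).trans_lt ENNReal.one_lt_top).ne
  have : probAt0 step n = (Qe step n 0).toReal := by
    rw [← Qe_eq, ENNReal.tsum_toReal_eq]
    · unfold probAt0
      refine tsum_congr fun w => ?_
      rw [hps]
      split_ifs
      · rw [ENNReal.toReal_prod]
        unfold pathProb
        exact Finset.prod_congr rfl fun i _ => (ENNReal.toReal_ofReal (h0 _)).symm
      · simp
    · intro w
      split_ifs
      · exact ENNReal.prod_ne_top fun i _ => ENNReal.ofReal_ne_top
      · simp
  rw [this, ENNReal.ofReal_toReal hne]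

lemma greenE_eq {step : Site d → ℝ} (h0 : ∀ z, 0 ≤ step z) (h1 : HasSum step 1) :
    greenE step = ∑' n, Qe step n 0 := tsum_congr fun n => probAt0_eq h0 h1 n

lemma exists_z0 {step : Site d → ℝ} (h0 : ∀ z, 0 ≤ step z) (h1 : HasSum step 1) (hG : greenE step ≠ ⊤) :
    ∃ z0, z0 ≠ 0 ∧ 0 < step z0 := by
  by_contra hc
  push Not at hc
  have hz : ∀ z, z ≠ 0 → step z = 0 := fun z hz => le_antisymm (hc z hz) (h0 z)
  have h10 : step 0 = 1 := (hasSum_single 0 hz).unique h1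
  apply hG
  rw [greenE_eq h0 h1]
  have : ∀ n, Qe step n 0 = 1 := by
    intro n
    induction n with
    | zero => simp [Qe]
    | succ n ih =>
      rw [Qe, tsum_eq_single 0]
      · simp [h10, ih]
      · intro u hu; simp [hz u hu]
  simp [this, ENNReal.tsum_const_eq_top_of_ne_zero]

/-- the system attached to a finite set -/
lemma exists_Sys {step : Site d → ℝ} (h0 : ∀ z, 0 ≤ step z) (h1 : HasSum step 1)
    {lam : ℝ} (hl : 0 < lam) (hG : greenE step ≠ ⊤) (V : Finset (Site d)) :
    ∃ S : Sys {x // x ∈ V}, S.s = lamS lam ∧ ∀ x z, S.p x z = step ((z : Site d) - x) := by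
  obtain ⟨z0, hz, ha⟩ := exists_z0 h0 h1 hG
  obtain ⟨H, hH, hH0⟩ := exists_H h0 h1 V hz ha
  exact ⟨{ p := fun x z => step ((z : Site d) - x), s := lamS lam, H := H, hp := fun _ _ => h0 _,
           hp1 := fun y => sum_shift_le h0 h1 V y, hs := lamS_pos hl,
           hs1 := by linarith [lamSJ hl, lamJ_pos hl], hH := hH, hH0 := hH0 }, rfl, fun _ _ => rfl⟩

lemma pw_le_Qe {step : Site d → ℝ} (h0 : ∀ z, 0 ≤ step z) (V : Finset (Site d)) (S : Sys {x // x ∈ V})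
    (hp : ∀ x z, S.p x z = step ((z : Site d) - x)) (x : {x // x ∈ V}) (k : ℕ) (y : {x // x ∈ V}) :
    ENNReal.ofReal (S.pw x k y) ≤ Qe step k ((x : Site d) - y) := by
  induction k generalizing y with
  | zero =>
    simp only [Sys.pw, Qe]
    by_cases h : y = x
    · simp [h]
    · simp [h]
  | succ k ih =>
    rw [Sys.pw, ENNReal.ofReal_sum_of_nonneg (fun z _ => mul_nonneg (S.hp _ _) (S.pw_nonneg _ _ _)), Qe]
    calc _ ≤ ∑ z : {x // x ∈ V}, ENNReal.ofReal (step ((z : Site d) - y)) * Qe step k ((x : Site d) - z) := by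
          refine Finset.sum_le_sum fun z _ => ?_
          rw [ENNReal.ofReal_mul (S.hp _ _), hp]
          exact mul_le_mul_right (ih z) _
      _ = ∑ z ∈ V, ENNReal.ofReal (step (z - y)) * Qe step k ((x : Site d) - z) :=
          Finset.sum_coe_sort V (fun z => ENNReal.ofReal (step (z - y)) * Qe step k ((x : Site d) - z))
      _ ≤ ∑' z, ENNReal.ofReal (step (z - y)) * Qe step k ((x : Site d) - z) := ENNReal.sum_le_tsum _
      _ = _ := by
          rw [← (Equiv.subRight (y : Site d)).tsum_eq (fun u => ENNReal.ofReal (step u) * Qe step k ((x : Site d) - y - u))]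
          refine tsum_congr fun z => ?_
          simp

lemma green_diag_le {step : Site d → ℝ} (h0 : ∀ z, 0 ≤ step z) (h1 : HasSum step 1) (hG : greenE step ≠ ⊤)
    (V : Finset (Site d)) (S : Sys {x // x ∈ V})
    (hp : ∀ x z, S.p x z = step ((z : Site d) - x)) (x : {x // x ∈ V}) (g) (hg : S.IsGreen x g) :
    g x ≤ (greenE step).toReal := by
  refine S.green_le hg _ fun K => ?_
  rw [← ENNReal.ofReal_le_iff_le_toReal hG, ENNReal.ofReal_sum_of_nonneg (fun k _ => S.pw_nonneg _ _ _),
    greenE_eq h0 h1]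
  refine le_trans (Finset.sum_le_sum fun k _ => ?_) (ENNReal.sum_le_tsum (range K))
  simpa using pw_le_Qe h0 V S hp x k x

def vs (A : Finset (Site d)) : ℕ → Finset (Site d)
  | 0 => {0}
  | k + 1 => vs A k ∪ (vs A k ×ˢ A).image (fun q => q.1 - q.2)

lemma vs_mono (A : Finset (Site d)) : Monotone (vs A) :=
  monotone_nat_of_le_succ fun k => Finset.subset_union_left

lemma vs_zero (A : Finset (Site d)) (k : ℕ) : (0 : Site d) ∈ vs A k :=
  vs_mono A (Nat.zero_le k) (by simp [vs])

lemma pw_mass {step : Site d → ℝ} (h0 : ∀ z, 0 ≤ step z) (A V : Finset (Site d)) (S : Sys {x // x ∈ V})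
    (hp : ∀ x z, S.p x z = step ((z : Site d) - x)) (hV : (0 : Site d) ∈ V) (k : ℕ) (hk : vs A k ⊆ V) :
    (∑ a ∈ A, step a) ^ k ≤ ∑ y ∈ univ.filter (fun y : {x // x ∈ V} => (y : Site d) ∈ vs A k), S.pw ⟨0, hV⟩ k y := by
  induction k with
  | zero =>
    have : univ.filter (fun y : {x // x ∈ V} => (y : Site d) ∈ vs A 0) = {⟨0, hV⟩} := by
      ext y; simp [vs, Subtype.ext_iff]
    rw [this]; simp [Sys.pw]
  | succ k ih =>
    have hk' : vs A k ⊆ V := (vs_mono A (Nat.le_succ k)).trans hk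
    have ih := ih hk'
    have hA : 0 ≤ ∑ a ∈ A, step a := Finset.sum_nonneg fun a _ => h0 a
    set T := univ.filter (fun y : {x // x ∈ V} => (y : Site d) ∈ vs A k)
    set T' := univ.filter (fun y : {x // x ∈ V} => (y : Site d) ∈ vs A (k + 1)) with hT'
    calc (∑ a ∈ A, step a) ^ (k + 1) ≤ (∑ y ∈ T, S.pw ⟨0, hV⟩ k y) * ∑ a ∈ A, step a := by
          rw [pow_succ]; exact mul_le_mul_of_nonneg_right ih hA
      _ = ∑ z ∈ T, (∑ a ∈ A, step a) * S.pw ⟨0, hV⟩ k z := by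
          rw [Finset.sum_mul]; exact Finset.sum_congr rfl fun z _ => mul_comm _ _
      _ ≤ ∑ z ∈ T, (∑ y ∈ T', S.p y z) * S.pw ⟨0, hV⟩ k z := by
          refine Finset.sum_le_sum fun z hz => mul_le_mul_of_nonneg_right ?_ (S.pw_nonneg _ _ _)
          have hz : (z : Site d) ∈ vs A k := (Finset.mem_filter.1 hz).2
          have hmem : ∀ a ∈ A, (z : Site d) - a ∈ vs A (k + 1) := fun a ha =>
            Finset.mem_union_right _ (Finset.mem_image.2 ⟨(z, a), Finset.mem_product.2 ⟨hz, ha⟩, rfl⟩)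
          have : ∑ a ∈ A, step a = ∑ a : {x // x ∈ A}, S.p ⟨(z : Site d) - a, hk (hmem a a.2)⟩ z := by
            rw [← Finset.sum_coe_sort A]
            refine Finset.sum_congr rfl fun a _ => ?_
            rw [hp]; simp
          rw [this, ← Finset.sum_image (s := univ) (f := fun y => S.p y z)
            (g := fun a : {x // x ∈ A} => (⟨(z : Site d) - a, hk (hmem a a.2)⟩ : {x // x ∈ V}))]
          · refine Finset.sum_le_sum_of_subset_of_nonneg ?_ (fun _ _ _ => S.hp _ _)
            intro y hy
            obtain ⟨a, _, rfl⟩ := Finset.mem_image.1 hy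
            exact Finset.mem_filter.2 ⟨Finset.mem_univ _, hmem a a.2⟩
          · intro a _ b _ h
            have : (z : Site d) - a = z - b := congrArg Subtype.val h
            exact Subtype.ext (by simpa using this)
      _ ≤ ∑ z, (∑ y ∈ T', S.p y z) * S.pw ⟨0, hV⟩ k z :=
          Finset.sum_le_sum_of_subset_of_nonneg (Finset.subset_univ _) fun z _ _ =>
            mul_nonneg (Finset.sum_nonneg fun y _ => S.hp _ _) (S.pw_nonneg _ _ _)
      _ = ∑ y ∈ T', S.pw ⟨0, hV⟩ (k + 1) y := by
          simp only [Sys.pw, Finset.sum_mul]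
          rw [Finset.sum_comm]

lemma exists_V {step : Site d → ℝ} (h0 : ∀ z, 0 ≤ step z) (h1 : HasSum step 1) (K : ℕ) :
    ∃ (V : Finset (Site d)) (hV : (0 : Site d) ∈ V), ∀ (S : Sys {x // x ∈ V})
      (hp : ∀ x z, S.p x z = step ((z : Site d) - x)) (g) (hg : S.IsGreen ⟨0, hV⟩ g), (K : ℝ) / 2 ≤ ∑ x, g x := by
  rcases Nat.eq_zero_or_pos K with rfl | hK
  · refine ⟨{0}, by simp, fun S hp g hg => ?_⟩
    have : 0 ≤ ∑ x, g x := Finset.sum_nonneg fun x _ => hg.nonneg S x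
    rw [Nat.cast_zero, zero_div]; exact this
  have hK' : (0 : ℝ) < K := by exact_mod_cast hK
  have hε : 1 - 1 / (2 * (K : ℝ)) < 1 := by
    have : 0 < 1 / (2 * (K : ℝ)) := by positivity
    linarith
  obtain ⟨A, hA⟩ := (h1.eventually (lt_mem_nhds hε)).exists
  refine ⟨vs A K, vs_zero A K, fun S hp g hg => ?_⟩
  have hhalf : ∀ k ∈ range K, (1 : ℝ) / 2 ≤ ∑ y, S.pw ⟨0, vs_zero A K⟩ k y := by
    intro k hk
    have hk : k < K := Finset.mem_range.1 hk
    have hkK : (k : ℝ) ≤ K := by exact_mod_cast hk.le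
    have e1 := pw_mass h0 A (vs A K) S hp (vs_zero A K) k (vs_mono A hk.le)
    have e2 : (1 : ℝ) / 2 ≤ (∑ a ∈ A, step a) ^ k := by
      have hb := one_add_mul_le_pow (a := -(1 / (2 * (K : ℝ)))) (by
        have : 1 / (2 * (K : ℝ)) ≤ 1 := by
          rw [div_le_one (by positivity)]
          have : (1 : ℝ) ≤ K := by exact_mod_cast hK
          linarith
        linarith) k
      have h3 : (k : ℝ) * (1 / (2 * (K : ℝ))) ≤ 1 / 2 := by
        rw [mul_one_div, div_le_div_iff₀ (by positivity) (by norm_num)]; linarith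
      have h4 : (1 + -(1 / (2 * (K : ℝ)))) ^ k ≤ (∑ a ∈ A, step a) ^ k := by
        refine pow_le_pow_left₀ ?_ (by linarith) k
        have : 1 / (2 * (K : ℝ)) ≤ 1 := by
          rw [div_le_one (by positivity)]
          have : (1 : ℝ) ≤ K := by exact_mod_cast hK
          linarith
        linarith
      linarith
    refine e2.trans (e1.trans ?_)
    exact Finset.sum_le_sum_of_subset_of_nonneg (Finset.subset_univ _) fun z _ _ => S.pw_nonneg _ _ _
  calc (K : ℝ) / 2 = ∑ k ∈ range K, (1 : ℝ) / 2 := by simp; ring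
    _ ≤ ∑ k ∈ range K, ∑ y, S.pw ⟨0, vs_zero A K⟩ k y := Finset.sum_le_sum hhalf
    _ = ∑ y, ∑ k ∈ range K, S.pw ⟨0, vs_zero A K⟩ k y := Finset.sum_comm
    _ ≤ ∑ y, g y := Finset.sum_le_sum fun y _ => S.pw_sum_le hg K y

end
end ARWP


open MeasureTheory ENNReal Filter Topology ARW

set_option linter.all false

namespace ARWP
noncomputable section

open Finset

variable {d : ℕ}

lemma key {step : Site d → ℝ} (h0 : ∀ z, 0 ≤ step z) (h1 : HasSum step 1)
    {lam : ℝ} (hl : 0 < lam) (hG : greenE step ≠ ⊤) (n : ℕ) (K : ℕ) :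
    ∃ (V : Finset (Site d)) (g : {x // x ∈ V} → ℝ), (∀ x, 0 ≤ g x) ∧ (K : ℝ) / 2 ≤ ∑ x, g x ∧ 1 ≤ ∑ x, g x ∧
      ∀ (η : Site d → ℕ) (b r : ℝ), (∀ x, η x ≤ n) → 0 ≤ b → 0 < r →
        ENNReal.ofReal (1 - ((n : ℝ) ^ 2 * (∑ x, g x) ^ 2 + 2 * (greenE step).toReal * (n * ∑ x, g x)
          - 2 * b * (∑ x, g x * ((η x : ℝ) - (greenE step).toReal * lamS lam)) + b ^ 2) / r ^ 2) ≤
        stackLaw d step lam (Ev V (initState d V η) 0 (b - r)) := by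
  obtain ⟨V, hV, hK⟩ := exists_V h0 h1 K
  obtain ⟨S, hs, hp⟩ := exists_Sys h0 h1 hl hG V
  choose G hGr using S.exists_green
  set o : {x // x ∈ V} := ⟨0, hV⟩ with ho
  have hg0 : ∀ x, 0 ≤ G o x := fun x => (hGr o).nonneg S x
  have hdiag : ∀ x, G x x ≤ (greenE step).toReal := fun x => green_diag_le h0 h1 hG V S hp x _ (hGr x)
  refine ⟨V, G o, hg0, hK S hp _ (hGr o), ?_, ?_⟩
  · have h2 : (1 : ℝ) ≤ G o o := by
      have := hGr o o
      have h3 : 0 ≤ ∑ z, S.p o z * G o z := Finset.sum_nonneg fun z _ => mul_nonneg (S.hp _ _) (hg0 z)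
      rw [if_pos rfl] at this; linarith
    exact h2.trans (Finset.single_le_sum (f := G o) (fun x _ => hg0 x) (Finset.mem_univ o))
  intro η b r hη hb hr
  haveI := (stackLaw_spec h0 h1 hl).1
  have hne : stackLaw d step lam (Ev V (initState d V η) 0 (b - r)) ≠ ⊤ := measure_ne_top _ _
  rw [ENNReal.ofReal_le_iff_le_toReal hne]
  have hmain := S.main_abs ((greenE step).toReal * lamS lam) G hGr (fun x => by
    rw [hs, mul_comm]; exact mul_le_mul_of_nonneg_right (hdiag x) (lamS_pos hl).le) o (fun x => η x) b r
    (stackLaw d step lam (Ev V (initState d V η) 0 (b - r))).toReal hb hr (fun m => by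
      rw [← ENNReal.ofReal_le_iff_le_toReal hne]
      exact connect0 V h0 h1 hl S hs hp hV (b - r) m η)
  refine le_trans ?_ hmain
  set X := ∑ x : {x // x ∈ V}, (η x : ℝ) * G o x with hX
  have hX0 : 0 ≤ X := Finset.sum_nonneg fun x _ => mul_nonneg (Nat.cast_nonneg _) (hg0 x)
  have hX1 : X ≤ n * ∑ x, G o x := by
    rw [hX, Finset.mul_sum]
    exact Finset.sum_le_sum fun x _ => mul_le_mul_of_nonneg_right (by exact_mod_cast hη x) (hg0 x)
  have e1 : X ^ 2 ≤ (n : ℝ) ^ 2 * (∑ x, G o x) ^ 2 := by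
    rw [← mul_pow]; exact pow_le_pow_left₀ hX0 hX1 2
  have e2 : 2 * G o o * X ≤ 2 * (greenE step).toReal * (n * ∑ x, G o x) :=
    mul_le_mul (by linarith [hdiag o]) hX1 hX0 (by positivity)
  have hr2 : 0 < r ^ 2 := by positivity
  refine sub_le_sub_left ((div_le_div_iff_of_pos_right hr2).2 ?_) 1
  linarith

instance : Fact ((0 : ℝ) < 1) := ⟨one_pos⟩

lemma exists_irr : ∃ a : AddCircle (1 : ℝ), addOrderOf a = 0 := by
  refine ⟨((√2 : ℝ) : AddCircle (1 : ℝ)), ?_⟩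
  rw [addOrderOf_eq_zero_iff']
  intro n hn h
  rw [← AddCircle.coe_nsmul, AddCircle.coe_eq_zero_iff] at h
  obtain ⟨k, hk⟩ := h
  simp only [zsmul_eq_mul, mul_one, nsmul_eq_mul] at hk
  have := irrational_sqrt_two.natCast_mul (m := n) hn.ne'
  exact this ⟨k, by rw [← hk]; simp⟩

lemma exists_nu (i0 : Fin d) (ρ : ℝ) (hρ : 0 ≤ ρ) :
    ∃ (n : ℕ) (ν : Measure (Site d → ℕ)), IsProbabilityMeasure ν ∧ IsTransErgodic ν ∧
      (∀ᵐ η ∂ν, ∀ x, η x ≤ n) ∧ ∀ x, (∫⁻ η, (η x : ℝ≥0∞) ∂ν) = ENNReal.ofReal ρ := by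
  obtain ⟨a, ha⟩ := exists_irr
  obtain ⟨n0, hn0⟩ := exists_nat_ge ρ
  set n : ℕ := n0 + 1 with hn
  have hnρ : ρ ≤ n := by rw [hn]; push_cast; linarith
  have hnpos : (0 : ℝ) < n := by rw [hn]; positivity
  set B : Set (AddCircle (1 : ℝ)) := Metric.closedBall 0 (ρ / n / 2) with hB
  have hBm : MeasurableSet B := Metric.isClosed_closedBall.measurableSet
  have hBv : volume B = ENNReal.ofReal (ρ / n) := by
    rw [hB, AddCircle.volume_closedBall]
    congr 1
    rw [min_eq_right] 
    · ring
    · have : ρ / n ≤ 1 := (div_le_one hnpos).2 hnρ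
      linarith
  classical
  let Φ : AddCircle (1 : ℝ) → Site d → ℕ := fun θ x => if θ + (x i0) • a ∈ B then n else 0
  have hΦ : Measurable Φ := by
    refine measurable_pi_iff.2 fun x => Measurable.ite ?_ measurable_const measurable_const
    exact (measurable_add_const _) hBm
  have hprob : IsProbabilityMeasure (volume : Measure (AddCircle (1 : ℝ))) :=
    ⟨by rw [AddCircle.measure_univ, ENNReal.ofReal_one]⟩
  have hshm : ∀ z : Site d, Measurable (shift z) := fun z =>
    measurable_pi_iff.2 fun x => measurable_pi_apply (x + z)
  have hsh : ∀ z : Site d, shift z ∘ Φ = Φ ∘ (fun θ => θ + (z i0) • a) := by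
    intro z; funext θ x
    simp only [Function.comp, shift, Φ, Pi.add_apply, add_smul]
    rw [show θ + ((x i0) • a + (z i0) • a) = θ + (z i0) • a + (x i0) • a by abel]
  have hinv : ∀ z, Measure.map (shift z) (Measure.map Φ volume) = Measure.map Φ volume := by
    intro z
    rw [Measure.map_map (hshm z) hΦ, hsh, ← Measure.map_map hΦ (measurable_add_const _)]
    rw [(measurePreserving_add_right volume ((z i0) • a)).map_eq]
  refine ⟨n, Measure.map Φ volume, Measure.isProbabilityMeasure_map hΦ.aemeasurable, ⟨hinv, ?_⟩, ?_, ?_⟩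
  · intro s hs hsinv
    rw [Measure.map_apply hΦ hs]
    refine (AddCircle.ergodic_add_right.2 ha).toPreErgodic.prob_eq_zero_or_one (hΦ hs) ?_
    have h := hsh (Pi.single i0 1)
    simp only [Pi.single_eq_same, one_smul] at h
    rw [← Set.preimage_comp, ← h, Set.preimage_comp, hsinv]
  · rw [ae_map_iff hΦ.aemeasurable]
    · refine Eventually.of_forall fun θ x => ?_
      simp only [Φ]; split_ifs <;> simp
    · have : {η : Site d → ℕ | ∀ x, η x ≤ n} = ⋂ x, {η | η x ≤ n} := by ext; simp
      rw [this]
      exact MeasurableSet.iInter fun x => measurableSet_le (measurable_pi_apply x) measurable_const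
  · intro x
    have hm : Measurable fun η : Site d → ℕ => (η x : ℝ≥0∞) :=
      (measurable_of_countable (fun k : ℕ => (k : ℝ≥0∞))).comp (measurable_pi_apply x)
    rw [lintegral_map hm hΦ]
    have : (fun θ => ((Φ θ x : ℕ) : ℝ≥0∞)) = ((fun θ => θ + (x i0) • a) ⁻¹' B).indicator (fun _ => (n : ℝ≥0∞)) := by
      funext θ
      simp only [Φ, Set.indicator, Set.mem_preimage]
      split_ifs <;> simp
    rw [this, lintegral_indicator_const ((measurable_add_const _) hBm),
      (measurePreserving_add_right volume ((x i0) • a)).measure_preimage hBm.nullMeasurableSet, hBv,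
      ← ENNReal.ofReal_natCast, ← ENNReal.ofReal_mul hnpos.le]
    congr 1
    field_simp

end
end ARWP


open MeasureTheory ENNReal Filter Topology ARW

set_option linter.all false

namespace ARWP
noncomputable section

open Finset

variable {d : ℕ}

lemma odom_tendsto {step : Site d → ℝ} (h0 : ∀ z, 0 ≤ step z) (h1 : HasSum step 1)
    {lam : ℝ} (hl : 0 < lam) (η : Site d → ℕ) (h : ∀ᵐ I ∂(stackLaw d step lam), odom0 I η ≠ ⊤) :
    Tendsto (fun k : ℕ => stackLaw d step lam {I | (k : ℕ∞) ≤ odom0 I η}) atTop (𝓝 0) := by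
  haveI := (stackLaw_spec h0 h1 hl).1
  have h2 := tendsto_measure_iInter_atTop (μ := stackLaw d step lam)
    (s := fun k : ℕ => {I : Stacks d | (k : ℕ∞) ≤ odom0 I η})
    (fun k => (measurable_odom η k).nullMeasurableSet)
    (fun k k' hk I (hI : (k' : ℕ∞) ≤ odom0 I η) =>
      show (k : ℕ∞) ≤ odom0 I η from le_trans (Nat.cast_le.2 hk) hI) ⟨0, measure_ne_top _ _⟩
  have h3 : stackLaw d step lam (⋂ k : ℕ, {I : Stacks d | (k : ℕ∞) ≤ odom0 I η}) = 0 := by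
    rw [← nonpos_iff_eq_zero, ← (ae_iff.1 h)]
    refine measure_mono fun I hI => ?_
    simp only [Set.mem_iInter, Set.mem_setOf_eq] at hI
    simp only [Set.mem_setOf_eq, not_not]
    exact ENat.eq_top_iff_forall_ge.2 hI
  rwa [h3] at h2

lemma alg_e (D A B E m : ℝ) (hD : D ≠ 0) :
    (1 - (A + B ^ 2) / D) + (2 * B / D) * m = (D - A - B ^ 2 + 2 * B * m) / D := by
  field_simp
  ring

set_option maxHeartbeats 1000000 in
lemma contra {step : Site d → ℝ} (h0 : ∀ z, 0 ≤ step z) (h1 : HasSum step 1)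
    {lam : ℝ} (hl : 0 < lam) (hG : greenE step ≠ ⊤) (ρ : ℝ) (hρ : (greenE step).toReal * lamS lam < ρ)
    (h : ∀ ν : Measure (Site d → ℕ), IsProbabilityMeasure ν → IsTransErgodic ν →
      (∫⁻ η, (η 0 : ℝ≥0∞) ∂ν) = ENNReal.ofReal ρ → Fixates d step lam ν) : False := by
  obtain ⟨z0, hz, -⟩ := exists_z0 h0 h1 hG
  obtain ⟨i0, -⟩ : ∃ i, z0 i ≠ 0 := by
    by_contra hc; push Not at hc; exact hz (funext hc)
  set Gr := (greenE step).toReal with hGr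
  set ζ := Gr * lamS lam with hζ
  have hGr0 : 0 ≤ Gr := ENNReal.toReal_nonneg
  have hζ0 : 0 ≤ ζ := mul_nonneg hGr0 (lamS_pos hl).le
  have hρ0 : 0 ≤ ρ := hζ0.trans hρ.le
  obtain ⟨n, ν, hν, herg, hbd, hmean⟩ := exists_nu i0 ρ hρ0
  have hfix := h ν hν herg (hmean 0)
  have hmeas : ∀ x : Site d, Measurable fun η : Site d → ℕ => (η x : ℝ) := fun x =>
    (measurable_of_countable (fun k : ℕ => (k : ℝ))).comp (measurable_pi_apply x)
  have hintg : ∀ x : Site d, Integrable (fun η : Site d → ℕ => (η x : ℝ)) ν := fun x =>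
    Integrable.of_bound (hmeas x).aestronglyMeasurable (n : ℝ) (hbd.mono fun η hη => by
      rw [Real.norm_of_nonneg (Nat.cast_nonneg _)]; exact_mod_cast hη x)
  have hmean' : ∀ x : Site d, ∫ η, (η x : ℝ) ∂ν = ρ := by
    intro x
    rw [integral_eq_lintegral_of_nonneg_ae (Eventually.of_forall fun η => Nat.cast_nonneg _)
      (hmeas x).aestronglyMeasurable]
    simp only [ENNReal.ofReal_natCast]
    rw [hmean x, ENNReal.toReal_ofReal hρ0]
  choose V g hg0 hgK hg1 hkey using fun K => key h0 h1 hl hG n K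
  set δ := ρ - ζ with hδ
  have hδ0 : 0 < δ := sub_pos.2 hρ
  set K0 : ℝ := ((n : ℝ) ^ 2 + 2 * Gr * n) / δ ^ 2 with hK0
  have hK00 : 0 ≤ K0 := by positivity
  set C : ℝ := K0 + 1 with hC
  set c : ℝ := (5 / 4) / (C - 1 / 2) ^ 2 with hc
  have hC2 : 0 < C - 1 / 2 := by rw [hC]; linarith
  have hc0 : 0 < c := by positivity
  set Sg : ℕ → ℝ := fun K => ∑ x, g K x with hSg
  set m : ℕ → ℝ := fun K => δ * Sg K with hm
  have hm0 : ∀ K, 0 < m K := fun K => mul_pos hδ0 (lt_of_lt_of_le one_pos (hg1 K))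
  set L : ℕ → (Site d → ℕ) → ℝ := fun K η =>
    1 - ((n : ℝ) ^ 2 * (Sg K) ^ 2 + 2 * Gr * (n * Sg K)
          - 2 * (C * m K) * (∑ x, g K x * ((η x : ℝ) - ζ)) + (C * m K) ^ 2) / ((C - 1 / 2) * m K) ^ 2 with hL
  have hLm : ∀ K, Measurable (L K) := by
    intro K
    have : Measurable fun η : Site d → ℕ => ∑ x, g K x * ((η x : ℝ) - ζ) :=
      Finset.measurable_fun_sum _ fun x _ => ((hmeas x).sub_const ζ).const_mul _
    simp only [hL]
    fun_prop
  have hIS : ∀ K, Integrable (fun η : Site d → ℕ => ∑ x, g K x * ((η x : ℝ) - ζ)) ν := fun K =>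
    integrable_finsetSum _ fun x _ => ((hintg x).sub (integrable_const ζ)).const_mul _
  have hLeq : ∀ K, L K = fun η => (1 - ((n : ℝ) ^ 2 * (Sg K) ^ 2 + 2 * Gr * (n * Sg K) + (C * m K) ^ 2) /
      ((C - 1 / 2) * m K) ^ 2) + (2 * (C * m K) / ((C - 1 / 2) * m K) ^ 2) * (∑ x, g K x * ((η x : ℝ) - ζ)) := by
    intro K; funext η; simp only [hL]; ring
  have hLint : ∀ K, Integrable (L K) ν := by
    intro K
    rw [hLeq]
    exact (integrable_const _).add ((hIS K).const_mul _)
  have hLval : ∀ K, c ≤ ∫ η, L K η ∂ν := by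
    intro K
    have hsum : ∫ η, (∑ x, g K x * (((η : Site d → ℕ) x : ℝ) - ζ)) ∂ν = m K := by
      have hgi : ∀ x : {x // x ∈ V K}, Integrable (fun η : Site d → ℕ => g K x * ((η x : ℝ) - ζ)) ν :=
        fun x => ((hintg x).sub (integrable_const ζ)).const_mul _
      rw [integral_finsetSum _ (fun x _ => hgi x)]
      have : ∀ x : {x // x ∈ V K}, ∫ η, g K x * (((η : Site d → ℕ) x : ℝ) - ζ) ∂ν = g K x * δ := by
        intro x
        rw [integral_const_mul, integral_sub (hintg x) (integrable_const ζ), hmean' x]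
        simp [hδ]
      simp only [this, hm, hSg]
      rw [← Finset.sum_mul, mul_comm]
    have hval : ∫ η, L K η ∂ν = (1 - ((n : ℝ) ^ 2 * (Sg K) ^ 2 + 2 * Gr * (n * Sg K) + (C * m K) ^ 2) /
      ((C - 1 / 2) * m K) ^ 2) + (2 * (C * m K) / ((C - 1 / 2) * m K) ^ 2) * m K := by
      rw [hLeq]
      rw [integral_add (integrable_const _) ((hIS K).const_mul _), integral_const_mul, hsum]
      simp
    rw [hval]
    have hS1 : 1 ≤ Sg K := hg1 K
    have hM : (n : ℝ) ^ 2 * (Sg K) ^ 2 + 2 * Gr * (n * Sg K) ≤ K0 * (m K) ^ 2 := by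
      have : K0 * (m K) ^ 2 = ((n : ℝ) ^ 2 + 2 * Gr * n) * (Sg K) ^ 2 := by
        simp only [hm, hK0]; field_simp
      rw [this]
      have h3 : Sg K ≤ (Sg K) ^ 2 := by nlinarith
      have h4 : 0 ≤ 2 * Gr * n := by positivity
      nlinarith
    have hmK := hm0 K
    have hden : 0 < ((C - 1 / 2) * m K) ^ 2 := by positivity
    have e : (1 - ((n : ℝ) ^ 2 * (Sg K) ^ 2 + 2 * Gr * (n * Sg K) + (C * m K) ^ 2) /
      ((C - 1 / 2) * m K) ^ 2) + (2 * (C * m K) / ((C - 1 / 2) * m K) ^ 2) * m K =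
      (((C - 1 / 2) * m K) ^ 2 - ((n : ℝ) ^ 2 * (Sg K) ^ 2 + 2 * Gr * (n * Sg K)) - (C * m K) ^ 2
        + 2 * (C * m K) * m K) / ((C - 1 / 2) * m K) ^ 2 := by
      exact alg_e _ _ _ 0 _ hden.ne'
    rw [e, hc, div_le_div_iff₀ (by positivity) hden]
    have : (5 / 4) * (m K) ^ 2 ≤ ((C - 1 / 2) * m K) ^ 2 - ((n : ℝ) ^ 2 * (Sg K) ^ 2 + 2 * Gr * (n * Sg K)) - (C * m K) ^ 2
        + 2 * (C * m K) * m K := by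
      have : K0 = C - 1 := by rw [hC]; ring
      rw [this] at hM
      nlinarith
    calc 5 / 4 * ((C - 1 / 2) * m K) ^ 2 = (5 / 4 * (m K) ^ 2) * (C - 1 / 2) ^ 2 := by ring
      _ ≤ _ := mul_le_mul_of_nonneg_right this (by positivity)
  have hst := (stackLaw_spec h0 h1 hl).1
  -- pointwise bound
  have hbound : ∀ η : Site d → ℕ, (∀ x, η x ≤ n) → ∀ K,
      ENNReal.ofReal (L K η) ≤ stackLaw d step lam {I | ((⌊δ * K / 4⌋₊ : ℕ) : ℕ∞) ≤ odom0 I η} := by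
    intro η hη K
    have hmK := hm0 K
    have hp1 : 0 < C * m K := mul_pos (by linarith) hmK
    have hp2 : 0 < (C - 1 / 2) * m K := mul_pos hC2 hmK
    have hk := hkey K η (C * m K) ((C - 1 / 2) * m K) hη (by first | exact hp1 | exact hp1.le) (by first | exact hp2 | exact hp2.le)
    refine le_trans hk ?_
    refine measure_mono (Ev_sub _ _ _ _ ?_)
    refine (Nat.floor_le (by positivity)).trans ?_
    have h5 : (K : ℝ) / 2 ≤ Sg K := hgK K
    have h6 : C * m K - (C - 1 / 2) * m K = m K / 2 := by ring
    rw [h6]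
    simp only [hm]
    nlinarith
  have hlim : Tendsto (fun K => ∫ η, max (L K η) 0 ∂ν) atTop (𝓝 (∫ η : Site d → ℕ, (0 : ℝ) ∂ν)) := by
    refine tendsto_integral_of_dominated_convergence (fun _ => (1 : ℝ))
      (fun K => ((hLm K).max measurable_const).aestronglyMeasurable) (integrable_const _) ?_ ?_
    · intro K
      filter_upwards [hbd] with η hη
      rw [Real.norm_of_nonneg (le_max_right _ _)]
      refine max_le ?_ zero_le_one
      have := (hbound η hη K).trans prob_le_one
      rwa [ENNReal.ofReal_le_one] at this
    · filter_upwards [hbd, hfix] with η hη hf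
      have h7 := odom_tendsto h0 h1 hl η hf
      have hfl : Tendsto (fun K : ℕ => ⌊δ * K / 4⌋₊) atTop atTop := by
        refine tendsto_nat_floor_atTop.comp ?_
        refine Tendsto.atTop_div_const (by norm_num) ?_
        exact Tendsto.const_mul_atTop hδ0 tendsto_natCast_atTop_atTop
      have h8 := (ENNReal.tendsto_toReal ENNReal.zero_ne_top).comp (h7.comp hfl)
      rw [ENNReal.toReal_zero] at h8
      refine squeeze_zero (fun K => le_max_right _ _) (fun K => ?_) h8
      refine max_le ?_ ENNReal.toReal_nonneg
      exact (ENNReal.ofReal_le_iff_le_toReal (measure_ne_top _ _)).1 (hbound η hη K)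
  rw [integral_zero] at hlim
  have : c ≤ 0 := by
    refine ge_of_tendsto hlim (Eventually.of_forall fun K => (hLval K).trans ?_)
    exact integral_mono (hLint K) ((hLint K).sup (integrable_const 0)) fun η => le_max_left _ _
  linarith

end
end ARWP

theorem arw_critDensity_le_green_mul_lamS (d : ℕ) (step : Site d → ℝ) (h0 : ∀ z, 0 ≤ step z) (h1 : HasSum step 1)
    (lam : ℝ) (hlam : 0 < lam) :
    ENNReal.ofReal (critDensity d step lam) ≤ greenE step * ENNReal.ofReal (lamS lam) := by
  by_cases hG : greenE step = ⊤
  · rw [hG, ENNReal.top_mul (by simpa using ARWP.lamS_pos hlam)]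
    exact le_top
  have hb : critDensity d step lam ≤ (greenE step).toReal * lamS lam := by
    unfold critDensity
    refine Real.sSup_le ?_ (mul_nonneg ENNReal.toReal_nonneg (ARWP.lamS_pos hlam).le)
    rintro ρ ⟨-, h⟩
    by_contra hc
    exact ARWP.contra h0 h1 hlam hG ρ (not_le.1 hc) h
  refine (ENNReal.ofReal_le_ofReal hb).trans ?_
  rw [ENNReal.ofReal_mul ENNReal.toReal_nonneg, ENNReal.ofReal_toReal hG]
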